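/- arXiv:math/0512003 — 2 statements merged into one kernel-verified Lean document; each statement's English description precedes it below -/
import Mathlib

section
/- Every measurable function f : 𝕋 → ℂ admits a trigonometric series expansion f(t) = ∑_{k∈ℤ} c_k e^{ikt} converging almost everywhere; that is, there exist complex coefficients (c_k)_{k∈ℤ} such that the symmetric partial sums S_N(t) = ∑_{|k|≤N} c_k e^{ikt} converge to f(t) for almost every t ∈ 𝕋. (Menshov's representation theorem; equivalently, ℤ is a Menshov spectrum.) -/
open MeasureTheory Filter Topology Real

instance : Fact (0 < 2 * π) := ⟨by positivity⟩

/-- The symmetric partial sum `S_N(t) = ∑_{k ∈ Λ, |k| ≤ N} c_k e^{ikt}` on the circle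
`𝕋 = ℝ/2πℤ`. -/
noncomputable def menshovPartialSum (Λ : Set ℤ) (c : ℤ → ℂ) (N : ℕ)
    (t : AddCircle (2 * π)) : ℂ :=
  ∑ k ∈ Finset.Icc (-(N : ℤ)) (N : ℤ), Λ.indicator c k * fourier k t

/-- A set `Λ ⊆ ℤ` is a Menshov spectrum if every measurable `f : 𝕋 → ℂ` admits a
representation `f(t) = ∑_{k ∈ Λ} c_k e^{ikt}` with symmetric partial sums converging
almost everywhere. -/
def IsMenshovSpectrum (Λ : Set ℤ) : Prop :=
  ∀ f : AddCircle (2 * π) → ℂ, Measurable f → ∃ c : ℤ → ℂ,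
    ∀ᵐ t : AddCircle (2 * π),
      Tendsto (fun N => menshovPartialSum Λ c N t) atTop (𝓝 (f t))

namespace Menshov

/-- Part of the trigonometric polynomial with coefficients `c` with frequencies in `A`. -/
noncomputable def T (A : Set ℤ) (t : AddCircle (2 * π)) : (ℤ →₀ ℂ) →ₗ[ℂ] ℂ :=
  Finsupp.linearCombination ℂ (A.indicator (fun k => (fourier k t : ℂ)))

/-- Frequency shift. -/
noncomputable def sh (r : ℤ) : (ℤ →₀ ℂ) →ₗ[ℂ] (ℤ →₀ ℂ) :=
  Finsupp.lmapDomain ℂ ℂ (fun k => k + r)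

lemma norm_fourier (k : ℤ) (t : AddCircle (2 * π)) : ‖(fourier k t : ℂ)‖ = 1 := by
  rw [fourier_apply]; exact Circle.norm_coe _

lemma T_apply (A : Set ℤ) (t : AddCircle (2 * π)) (c : ℤ →₀ ℂ) :
    T A t c = ∑ k ∈ c.support, c k * A.indicator (fun k => (fourier k t : ℂ)) k := by
  simp [T, Finsupp.linearCombination_apply, Finsupp.sum]

lemma T_congr {A B : Set ℤ} {t : AddCircle (2 * π)} {c : ℤ →₀ ℂ}
    (h : ∀ k, c k ≠ 0 → (k ∈ A ↔ k ∈ B)) : T A t c = T B t c := by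
  rw [T_apply, T_apply]
  refine Finset.sum_congr rfl fun k hk => ?_
  have := h k (by simpa using hk)
  by_cases hA : k ∈ A
  · simp [hA, this.1 hA]
  · have hB : k ∉ B := fun hb => hA (this.2 hb)
    simp [hA, hB]

lemma T_empty (t : AddCircle (2 * π)) (c : ℤ →₀ ℂ) : T ∅ t c = 0 := by
  simp [T_apply]

lemma T_compl (A : Set ℤ) (t : AddCircle (2 * π)) (c : ℤ →₀ ℂ) :
    T Aᶜ t c = T Set.univ t c - T A t c := by
  rw [T_apply, T_apply, T_apply, ← Finset.sum_sub_distrib]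
  refine Finset.sum_congr rfl fun k _ => ?_
  by_cases hA : k ∈ A <;> simp [hA]

lemma T_sh (A : Set ℤ) (t : AddCircle (2 * π)) (c : ℤ →₀ ℂ) (r : ℤ) :
    T A t (sh r c) = fourier r t * T {k | k + r ∈ A} t c := by
  simp only [T, sh, Finsupp.lmapDomain_apply]
  rw [Finsupp.linearCombination_mapDomain]
  simp only [Finsupp.linearCombination_apply, Finsupp.sum, Finset.mul_sum]
  refine Finset.sum_congr rfl fun k _ => ?_
  by_cases hA : k + r ∈ A
  · simp only [Set.indicator, hA, Set.mem_ofPred_eq, if_true, Function.comp, fourier_add, smul_eq_mul]; ring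
  · simp [hA, Set.indicator]

lemma sh_apply (r : ℤ) (c : ℤ →₀ ℂ) (k : ℤ) : sh r c k = c (k - r) := by
  have : k = (fun k => k + r) (k - r) := by simp
  simp only [sh, Finsupp.lmapDomain_apply]
  conv_lhs => rw [this]
  rw [Finsupp.mapDomain_apply (add_left_injective r)]

lemma T_bound (c : ℤ →₀ ℂ) : ∃ G : ℝ, 1 ≤ G ∧ ∀ A t, ‖T A t c‖ ≤ G := by
  refine ⟨1 + ∑ k ∈ c.support, ‖c k‖, by
    have : 0 ≤ ∑ k ∈ c.support, ‖c k‖ := Finset.sum_nonneg fun _ _ => norm_nonneg _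
    linarith, fun A t => ?_⟩
  rw [T_apply]
  refine (norm_sum_le _ _).trans ?_
  have : ∑ k ∈ c.support, ‖c k * A.indicator (fun k => (fourier k t : ℂ)) k‖
      ≤ ∑ k ∈ c.support, ‖c k‖ := by
    refine Finset.sum_le_sum fun k _ => ?_
    rw [norm_mul]
    have : ‖A.indicator (fun k => (fourier k t : ℂ)) k‖ ≤ 1 := by
      refine (norm_indicator_le_norm_self _ _).trans ?_
      rw [norm_fourier]
    nlinarith [norm_nonneg (c k)]
  linarith

lemma continuous_T (A : Set ℤ) (c : ℤ →₀ ℂ) : Continuous fun t => T A t c := by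
  simp only [T_apply]
  refine continuous_finsetSum _ fun k _ => ?_
  by_cases hA : k ∈ A
  · simp only [hA, Set.indicator_of_mem]; fun_prop
  · simp only [hA, not_false_eq_true, Set.indicator_of_notMem]; fun_prop

/-- One step of the Riesz-product construction. -/
noncomputable def step (a : ℝ) (r : ℤ) (c : ℤ →₀ ℂ) : ℤ →₀ ℂ :=
  c + ((a / 2 : ℝ) : ℂ) • (sh r c + sh (-r) c)

lemma T_step (A : Set ℤ) (t : AddCircle (2 * π)) (c : ℤ →₀ ℂ) (r : ℤ) (a : ℝ) :
    T A t (step a r c) = T A t c + ((a / 2 : ℝ) : ℂ) *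
      (fourier r t * T {k | k + r ∈ A} t c + fourier (-r) t * T {k | k + -r ∈ A} t c) := by
  simp only [step, map_add, map_smul, T_sh, smul_eq_mul]

lemma T_step_univ (t : AddCircle (2 * π)) (c : ℤ →₀ ℂ) (r : ℤ) (a : ℝ) :
    T Set.univ t (step a r c) =
      T Set.univ t c * ((1 + a * (fourier r t : ℂ).re : ℝ) : ℂ) := by
  rw [T_step]
  simp only [Set.mem_univ, Set.ofPred_true, fourier_neg]
  have h := Complex.add_conj (fourier r t : ℂ)
  have : T Set.univ t c + ((a / 2 : ℝ) : ℂ) * (fourier r t * T Set.univ t c +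
      (starRingEnd ℂ) (fourier r t) * T Set.univ t c) = T Set.univ t c *
      (1 + ((a / 2 : ℝ) : ℂ) * ((fourier r t : ℂ) + (starRingEnd ℂ) (fourier r t : ℂ))) := by ring
  rw [this, h]
  push_cast
  ring

lemma step_apply (c : ℤ →₀ ℂ) (r : ℤ) (a : ℝ) (k : ℤ) :
    step a r c k = c k + ((a / 2 : ℝ) : ℂ) * (c (k - r) + c (k + r)) := by
  simp [step, sh_apply]; ring

lemma norm_aux {a : ℝ} (ha : 0 ≤ a) (r : ℤ) (t : AddCircle (2 * π)) (x y : ℂ) {X Y : ℝ}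
    (hx : ‖x‖ ≤ X) (hy : ‖y‖ ≤ Y) :
    ‖((a / 2 : ℝ) : ℂ) * (fourier r t * x + fourier (-r) t * y)‖ ≤ a / 2 * (X + Y) := by
  rw [norm_mul, Complex.norm_real, Real.norm_of_nonneg (by positivity)]
  refine mul_le_mul_of_nonneg_left ?_ (by positivity)
  refine (norm_add_le _ _).trans ?_
  rw [norm_mul, norm_mul, norm_fourier, norm_fourier]
  linarith

lemma step_H {c : ℤ →₀ ℂ} {D r : ℤ} (hD0 : 0 ≤ D) (hD : ∀ k, c k ≠ 0 → |k| ≤ D)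
    (hr : 2 * D + 1 < r) {a : ℝ} (ha : 0 ≤ a) (ha1 : a ≤ 1) (t : AddCircle (2 * π)) {v h K : ℝ}
    (hv : ‖T Set.univ t c‖ ≤ v) (hh : ∀ m, ‖T {k | k ≤ m} t c‖ ≤ h)
    (h1 : h + a / 2 * v ≤ K) (h2 : (1 + a / 2) * v + a / 2 * h ≤ K) (m : ℤ) :
    ‖T {k | k ≤ m} t (step a r c)‖ ≤ K := by
  have hv0 : 0 ≤ v := (norm_nonneg _).trans hv
  have hh0 : 0 ≤ h := (norm_nonneg _).trans (hh 0)
  rw [T_step]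
  refine (norm_add_le _ _).trans ?_
  simp only [Set.mem_ofPred_eq]
  have e1 : {k : ℤ | k + r ≤ m} = {k | k ≤ m - r} := by ext; simp; omega
  have e2 : {k : ℤ | k + -r ≤ m} = {k | k ≤ m + r} := by ext; simp
  rw [e1, e2]
  rcases lt_or_ge m (-D) with hm | hm
  · have z1 : T {k | k ≤ m} t c = 0 := by
      rw [← T_empty t c]; apply T_congr; intro k hk
      have := abs_le.1 (hD k hk); simp; omega
    have z2 : T {k | k ≤ m - r} t c = 0 := by
      rw [← T_empty t c]; apply T_congr; intro k hk
      have := abs_le.1 (hD k hk); simp; omega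
    have := norm_aux ha r t (T {k | k ≤ m - r} t c) (T {k | k ≤ m + r} t c) (X := 0) (Y := h)
      (by rw [z2]; simp) (hh _)
    rw [z1, norm_zero]
    nlinarith
  · have z3 : T {k | k ≤ m + r} t c = T Set.univ t c := by
      apply T_congr; intro k hk
      have := abs_le.1 (hD k hk); simp; omega
    rcases le_or_gt m D with hm' | hm'
    · have z2 : T {k | k ≤ m - r} t c = 0 := by
        rw [← T_empty t c]; apply T_congr; intro k hk
        have := abs_le.1 (hD k hk); simp; omega
      have := norm_aux ha r t (T {k | k ≤ m - r} t c) (T {k | k ≤ m + r} t c) (X := 0) (Y := v)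
        (by rw [z2]; simp) (by rw [z3]; exact hv)
      have := hh m
      linarith
    · have z1 : T {k | k ≤ m} t c = T Set.univ t c := by
        apply T_congr; intro k hk
        have := abs_le.1 (hD k hk); simp; omega
      have := norm_aux ha r t (T {k | k ≤ m - r} t c) (T {k | k ≤ m + r} t c) (X := h) (Y := v)
        (hh _) (by rw [z3]; exact hv)
      rw [z1]
      linarith

lemma step_S_small {c : ℤ →₀ ℂ} {D r : ℤ} (hD : ∀ k, c k ≠ 0 → |k| ≤ D)
    (hr : 2 * D + 1 < r) {a : ℝ} (t : AddCircle (2 * π)) {n : ℤ} (hn : n ≤ D) :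
    T {k | |k| ≤ n} t (step a r c) = T {k | |k| ≤ n} t c := by
  rw [T_step]
  have z1 : T {k | k + r ∈ {k : ℤ | |k| ≤ n}} t c = 0 := by
    rw [← T_empty t c]; apply T_congr; intro k hk
    have := abs_le.1 (hD k hk); simp [abs_le]; omega
  have z2 : T {k | k + -r ∈ {k : ℤ | |k| ≤ n}} t c = 0 := by
    rw [← T_empty t c]; apply T_congr; intro k hk
    have := abs_le.1 (hD k hk); simp [abs_le]; omega
  rw [z1, z2]; simp

lemma step_S_large {c : ℤ →₀ ℂ} {D r : ℤ} (hD0 : 0 ≤ D) (hD : ∀ k, c k ≠ 0 → |k| ≤ D)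
    (hr : 2 * D + 1 < r) {a : ℝ} (ha : 0 ≤ a) (t : AddCircle (2 * π)) {v h : ℝ}
    (hv : ‖T Set.univ t c‖ ≤ v) (hh : ∀ m, ‖T {k | k ≤ m} t c‖ ≤ h) {n : ℤ} (hn : D ≤ n) :
    ‖T {k | |k| ≤ n} t (step a r c) - T Set.univ t c‖ ≤ a / 2 * (h + (v + h)) := by
  rw [T_step]
  have z1 : T {k | k + r ∈ {k : ℤ | |k| ≤ n}} t c = T {k | k ≤ n - r} t c := by
    apply T_congr; intro k hk
    have := abs_le.1 (hD k hk); simp [abs_le]; omega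
  have z2 : T {k | k + -r ∈ {k : ℤ | |k| ≤ n}} t c = T {k | k ≤ r - n - 1}ᶜ t c := by
    apply T_congr; intro k hk
    have := abs_le.1 (hD k hk); simp [abs_le]; omega
  have z3 : T {k | |k| ≤ n} t c = T Set.univ t c := by
    apply T_congr; intro k hk
    have := hD k hk; simp; omega
  rw [z1, z2, z3, add_sub_cancel_left]
  apply norm_aux ha _ _ _ _ (hh _)
  rw [T_compl]
  refine (norm_sub_le _ _).trans ?_
  exact add_le_add hv (hh _)

lemma step_supp {c : ℤ →₀ ℂ} {D r : ℤ} (hD0 : 0 ≤ D) (hD : ∀ k, c k ≠ 0 → |k| ≤ D)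
    (hr : 2 * D + 1 < r) {a : ℝ} (k : ℤ) (hk : step a r c k ≠ 0) : |k| ≤ D + r := by
  by_contra hcon
  push Not at hcon
  apply hk
  have key : ∀ j, D < |j| → c j = 0 := fun j hj => by
    by_contra h; exact absurd (hD j h) (by omega)
  rw [step_apply, key k (by omega), key (k - r), key (k + r)]
  · simp
  · rcases abs_cases k with h | h <;> rcases abs_cases (k + r) with h' | h' <;> omega
  · rcases abs_cases k with h | h <;> rcases abs_cases (k - r) with h' | h' <;> omega

lemma step_coeff {c : ℤ →₀ ℂ} {D r : ℤ} (hD : ∀ k, c k ≠ 0 → |k| ≤ D)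
    (hr : 2 * D + 1 < r) {a : ℝ} (k : ℤ) (hk : |k| ≤ D) : step a r c k = c k := by
  have key : ∀ j, D < |j| → c j = 0 := fun j hj => by
    by_contra h; exact absurd (hD j h) (by omega)
  rw [step_apply, key (k - r), key (k + r)]
  · simp
  · rcases abs_cases k with h | h <;> rcases abs_cases (k + r) with h' | h' <;> omega
  · rcases abs_cases k with h | h <;> rcases abs_cases (k - r) with h' | h' <;> omega


/-- The normalised Haar measure on the circle. -/
noncomputable abbrev μ : Measure (AddCircle (2 * π)) := AddCircle.haarAddCircle

lemma rl {h : AddCircle (2 * π) → ℝ} (hm : Measurable h) {M : ℝ} (hM : ∀ t, |h t| ≤ M) :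
    Tendsto (fun r : ℕ => ∫ t, h t * (fourier (r : ℤ) t : ℂ).re ∂μ) atTop (𝓝 0) := by
  have hL : MemLp (fun t => (h t : ℂ)) 2 μ :=
    MemLp.of_bound (by fun_prop) M (Eventually.of_forall fun t => by simpa using hM t)
  have h1 := (hasSum_sq_fourierCoeff hL.toLp).summable.tendsto_cofinite_zero
  have h2 : Tendsto (fun r : ℕ => ‖fourierCoeff (hL.toLp) (r : ℤ)‖ ^ 2) atTop (𝓝 0) := by
    rw [← Nat.cofinite_eq_atTop]
    exact h1.comp Nat.cast_injective.tendsto_cofinite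
  have h3 : Tendsto (fun r : ℕ => ‖fourierCoeff (hL.toLp) (r : ℤ)‖) atTop (𝓝 0) := by
    have := h2.sqrt
    simpa [Real.sqrt_sq] using this
  refine squeeze_zero_norm (fun r => ?_) h3
  have e : fourierCoeff (hL.toLp) (r : ℤ) = fourierCoeff (fun t => (h t : ℂ)) (r : ℤ) :=
    congrFun (fourierCoeff_congr_ae hL.coeFn_toLp) _
  rw [e, fourierCoeff]
  have hi : Integrable (fun t => (fourier (-(r : ℤ)) t : ℂ) • (h t : ℂ)) μ :=
    (hL.integrable (by norm_num)).fourier_smul _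
  have : ∫ t, h t * (fourier (r : ℤ) t : ℂ).re ∂μ
      = (∫ t, (fourier (-(r : ℤ)) t : ℂ) • (h t : ℂ) ∂μ).re := by
    have := integral_re hi
    simp only [RCLike.re_to_complex] at this
    rw [← this]
    refine integral_congr_ae (Eventually.of_forall fun t => ?_)
    simp only [fourier_neg, smul_eq_mul, Complex.mul_re, Complex.conj_re, Complex.ofReal_re,
      Complex.ofReal_im, mul_zero, sub_zero]
    ring
  rw [this]
  exact Complex.abs_re_le_norm _

lemma sqrt_aux {x : ℝ} (hx : |x| ≤ 1) : √(1 + x) ≤ 1 + x / 2 - x ^ 2 / 16 := by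
  obtain ⟨h1, h2⟩ := abs_le.1 hx
  apply Real.sqrt_le_iff.2
  constructor
  · nlinarith
  · nlinarith [mul_nonneg (sq_nonneg x) (sub_nonneg.2 h2), sq_nonneg (x^2), sq_nonneg x]

lemma re_fourier_two (r : ℤ) (t : AddCircle (2 * π)) :
    (fourier (2 * r) t : ℂ).re = 2 * (fourier r t : ℂ).re ^ 2 - 1 := by
  have h := norm_fourier r t
  have h2 : (fourier r t : ℂ).re ^ 2 + (fourier r t : ℂ).im ^ 2 = 1 := by
    have := Complex.sq_norm (fourier r t : ℂ)
    rw [h, Complex.normSq_apply] at this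
    nlinarith
  rw [show (2 * r : ℤ) = r + r by ring, fourier_add, Complex.mul_re]
  nlinarith

lemma abs_re_fourier (r : ℤ) (t : AddCircle (2 * π)) : |(fourier r t : ℂ).re| ≤ 1 :=
  (Complex.abs_re_le_norm _).trans (norm_fourier r t).le

lemma exists_seq {δ : ℝ} (hδ : 0 < δ) : ∃ a : ℕ → ℝ, (∀ j, 0 < a j ∧ a j ≤ 1 / 2) ∧
    (∀ j, a j * (3 + ∑ i ∈ Finset.range j, a i) ≤ δ) ∧
    Tendsto (fun J => ∏ i ∈ Finset.range J, (1 - a i ^ 2 / 64)) atTop (𝓝 0) := by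
  obtain ⟨α, hα0, hα1, hα2⟩ : ∃ α : ℝ, 0 < α ∧ α ≤ 1 / 2 ∧ 5 * α ≤ δ :=
    ⟨min (1 / 2) (δ / 5), by positivity, min_le_left _ _, by
      have := min_le_right (1 / 2 : ℝ) (δ / 5); linarith⟩
  have hs : ∀ j : ℕ, 1 ≤ √((j : ℝ) + 1) := fun j => by
    rw [Real.one_le_sqrt]; linarith [(Nat.cast_nonneg j : (0 : ℝ) ≤ j)]
  have hle : ∀ j : ℕ, α / √((j : ℝ) + 1) ≤ α := fun j => div_le_self hα0.le (hs j)
  have hpos : ∀ j : ℕ, 0 < α / √((j : ℝ) + 1) := fun j => div_pos hα0 (by linarith [hs j])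
  refine ⟨fun j => α / √((j : ℝ) + 1), fun j => ⟨hpos j, (hle j).trans hα1⟩, fun j => ?_, ?_⟩
  · have hsum : ∀ j : ℕ, ∑ i ∈ Finset.range j, α / √((i : ℝ) + 1) ≤ 2 * α * √(j : ℝ) := by
      intro j
      induction j with
      | zero => simp
      | succ j ih =>
        rw [Finset.sum_range_succ]
        have h1 := hs j
        have h2 : √(j : ℝ) ^ 2 = j := Real.sq_sqrt (Nat.cast_nonneg j)
        have h3 : √((j : ℝ) + 1) ^ 2 = j + 1 := Real.sq_sqrt (by positivity)
        have h4 : α / √((j : ℝ) + 1) ≤ 2 * α * (√((j : ℝ) + 1) - √(j : ℝ)) := by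
          rw [div_le_iff₀ (by linarith)]
          nlinarith [mul_nonneg hα0.le (sq_nonneg (√((j : ℝ) + 1) - √(j : ℝ)))]
        push_cast
        linarith
    have h1 := hsum j
    have h2 : √(j : ℝ) ≤ √((j : ℝ) + 1) := Real.sqrt_le_sqrt (by linarith)
    have h3 : α / √((j : ℝ) + 1) * √((j : ℝ) + 1) = α := by
      have := hs j; field_simp
    have h4 := hle j
    have h5 := hpos j
    calc α / √((j : ℝ) + 1) * (3 + ∑ i ∈ Finset.range j, α / √((i : ℝ) + 1))
        ≤ α / √((j : ℝ) + 1) * (3 + 2 * α * √((j : ℝ) + 1)) := by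
          apply mul_le_mul_of_nonneg_left _ h5.le
          nlinarith
      _ = 3 * (α / √((j : ℝ) + 1)) + 2 * α * (α / √((j : ℝ) + 1) * √((j : ℝ) + 1)) := by ring
      _ ≤ δ := by rw [h3]; nlinarith
  · have hdiv : Tendsto (fun J : ℕ => ∑ i ∈ Finset.range J, (1 / ((i : ℝ) + 1))) atTop atTop :=
      Real.tendsto_sum_range_one_div_nat_succ_atTop
    have hexp : Tendsto (fun J : ℕ => Real.exp (-(α ^ 2 / 64 *
        ∑ i ∈ Finset.range J, (1 / ((i : ℝ) + 1))))) atTop (𝓝 0) :=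
      Real.tendsto_exp_neg_atTop_nhds_zero.comp (hdiv.const_mul_atTop (by positivity))
    have hsq : ∀ i : ℕ, (α / √((i : ℝ) + 1)) ^ 2 / 64 = α ^ 2 / 64 * (1 / ((i : ℝ) + 1)) := by
      intro i
      rw [div_pow, Real.sq_sqrt (by positivity)]; ring
    have h1 : ∀ i : ℕ, 0 ≤ 1 - (α / √((i : ℝ) + 1)) ^ 2 / 64 := fun i => by
      have := hle i; have := hpos i; nlinarith
    refine squeeze_zero (fun J => Finset.prod_nonneg fun i _ => h1 i) (fun J => ?_) hexp
    rw [Finset.mul_sum, ← Finset.sum_neg_distrib, Real.exp_sum]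
    refine Finset.prod_le_prod (fun i _ => h1 i) fun i _ => ?_
    rw [hsq]
    have := Real.add_one_le_exp (-(α ^ 2 / 64 * (1 / ((i : ℝ) + 1))))
    linarith


/-- State of the Riesz-product construction after `j` steps. -/
structure St (g : ℤ →₀ ℂ) (N : ℤ) (lam G δ : ℝ) (a : ℕ → ℝ) (j : ℕ) (D : ℤ) (R : ℤ →₀ ℂ)
    (Q : AddCircle (2 * π) → ℝ) (B : Set (AddCircle (2 * π))) : Prop where
  D0 : 0 ≤ D
  ND : N ≤ D
  gD : ∀ k, g k ≠ 0 → |k| ≤ D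
  RD : ∀ k, R k ≠ 0 → |k| ≤ D
  coeff : ∀ k, |k| ≤ N → R k = g k
  Qc : Continuous Q
  Qpos : ∀ t, 0 < Q t
  eval : ∀ t, T Set.univ t R = T Set.univ t g * (Q t : ℂ)
  sq : ∫ t, √(Q t) ∂μ ≤ ∏ i ∈ Finset.range j, (1 - a i ^ 2 / 64)
  Bm : MeasurableSet B
  W : ∫ t, (B.indicator (fun _ => lam) t + Bᶜ.indicator Q t) ∂μ < 2
  Qle : ∀ t, t ∉ B → Q t ≤ lam
  H : ∀ t, t ∉ B → ∀ m, ‖T {k | k ≤ m} t R‖ ≤ lam * G * (3 + ∑ i ∈ Finset.range j, a i)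
  S : ∀ t, t ∉ B → ∀ n : ℤ, ‖T {k | |k| ≤ n} t (g - R)‖
    ≤ (1 + 2 * lam) * ‖T Set.univ t g‖ + δ

lemma bdd_of_cont {Q : AddCircle (2 * π) → ℝ} (hQ : Continuous Q) : ∃ M, ∀ t, |Q t| ≤ M := by
  obtain ⟨M, hM⟩ := isCompact_univ.exists_bound_of_continuousOn hQ.continuousOn
  exact ⟨M, fun t => hM t (Set.mem_univ t)⟩

lemma integrable_of_bdd {h : AddCircle (2 * π) → ℝ} (hm : Measurable h) {M : ℝ}
    (hM : ∀ t, |h t| ≤ M) : Integrable h μ :=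
  Integrable.of_bound hm.aestronglyMeasurable M (Eventually.of_forall hM)

lemma meas_re_fourier (r : ℤ) :
    Continuous (fun t : AddCircle (2 * π) => (fourier r t : ℂ).re) :=
  Complex.continuous_re.comp (fourier r).continuous

lemma St_zero (g : ℤ →₀ ℂ) (N : ℤ) {lam G δ : ℝ} (hlam : 1 ≤ lam) (hδ : 0 ≤ δ) (hG1 : 1 ≤ G)
    (hG : ∀ A t, ‖T A t g‖ ≤ G) (a : ℕ → ℝ) :
    ∃ D, St g N lam G δ a 0 D g (fun _ => 1) ∅ := by
  obtain ⟨D, hD⟩ : ∃ D : ℤ, ∀ k, g k ≠ 0 → |k| ≤ D := by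
    refine ⟨∑ k ∈ g.support, |k|, fun k hk => ?_⟩
    exact Finset.single_le_sum (f := fun k : ℤ => |k|) (fun _ _ => abs_nonneg _)
      (by simpa using hk)
  refine ⟨max (max D N) 0, ?_⟩
  have hgD : ∀ k, g k ≠ 0 → |k| ≤ max (max D N) 0 := fun k hk => (hD k hk).trans (by simp)
  refine ⟨by simp, by simp, hgD, hgD, fun _ _ => rfl, continuous_const, fun _ => one_pos,
    by simp, by simp, MeasurableSet.empty, by simp, fun _ _ => hlam, fun t _ m => ?_,
    fun t _ n => ?_⟩
  · have := hG {k | k ≤ m} t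
    simp only [Finset.range_zero, Finset.sum_empty]
    nlinarith
  · simp only [sub_self, map_zero, norm_zero]
    positivity

lemma choose_r {lam : ℝ} (hlam : 1 ≤ lam) {a : ℝ} (ha0 : 0 < a) (ha1 : a ≤ 1 / 2)
    {Q : AddCircle (2 * π) → ℝ} {B : Set (AddCircle (2 * π))}
    (hQc : Continuous Q) (hQp : ∀ t, 0 < Q t) (hB : MeasurableSet B)
    (hW : ∫ t, (B.indicator (fun _ => lam) t + Bᶜ.indicator Q t) ∂μ < 2) (L : ℕ) :
    ∃ r : ℕ, L < r ∧
      ∫ t, √(Q t * (1 + a * (fourier (r : ℤ) t : ℂ).re)) ∂μ ≤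
        (1 - a ^ 2 / 64) * ∫ t, √(Q t) ∂μ ∧
      ∫ t, (B.indicator (fun _ => lam) t + Bᶜ.indicator
        (fun t => Q t * (1 + a * (fourier (r : ℤ) t : ℂ).re)) t) ∂μ < 2 := by
  obtain ⟨M, hM⟩ := bdd_of_cont hQc
  have hsc : Continuous fun t => √(Q t) := hQc.sqrt
  obtain ⟨M', hM'⟩ := bdd_of_cont hsc
  have hM0 : 0 ≤ M := (abs_nonneg _).trans (hM 0)
  have hindm : Measurable (Bᶜ.indicator Q) := hQc.measurable.indicator hB.compl
  have hindb : ∀ t, |Bᶜ.indicator Q t| ≤ M := fun t => by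
    by_cases h : t ∈ Bᶜ
    · simpa [Set.indicator_of_mem h] using hM t
    · simpa [Set.indicator_of_notMem h] using hM0
  have hsi : Integrable (fun t => √(Q t)) μ := integrable_of_bdd hsc.measurable hM'
  have hsp : 0 < ∫ t, √(Q t) ∂μ := by
    rw [integral_pos_iff_support_of_nonneg (fun t => Real.sqrt_nonneg _) hsi]
    have : Function.support (fun t => √(Q t)) = Set.univ := by
      ext t; simpa using (Real.sqrt_pos.2 (hQp t)).ne'
    rw [this]; simp
  have t1 := rl hsc.measurable hM'
  have t2 : Tendsto (fun r : ℕ => ∫ t, √(Q t) * (fourier ((2 * r : ℕ) : ℤ) t : ℂ).re ∂μ)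
      atTop (𝓝 0) := t1.comp (tendsto_id.const_mul_atTop' (by norm_num))
  have t3 := rl hindm hindb
  have t4 := (t1.const_mul (a / 2)).sub (t2.const_mul (a ^ 2 / 32))
  have t5 := t3.const_mul a
  simp only [mul_zero, sub_zero] at t4 t5
  have e4 := t4.eventually_lt_const (show 0 < a ^ 2 / 64 * ∫ t, √(Q t) ∂μ by positivity)
  have e5 := t5.eventually_lt_const (sub_pos.2 hW)
  obtain ⟨r, h4, h5, hr⟩ := (e4.and (e5.and (eventually_gt_atTop L))).exists
  have hmul : ∀ (h : AddCircle (2 * π) → ℝ) (k : ℤ), Integrable h μ →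
      Integrable (fun t => h t * (fourier k t : ℂ).re) μ := fun h k hh => by
    refine hh.mul_bdd (c := 1) (meas_re_fourier k).measurable.aestronglyMeasurable ?_
    exact Eventually.of_forall fun t => abs_re_fourier k t
  refine ⟨r, hr, ?_, ?_⟩
  · have hle : ∫ t, √(Q t * (1 + a * (fourier (r : ℤ) t : ℂ).re)) ∂μ ≤
        ∫ t, ((1 - a ^ 2 / 32) * √(Q t) + (a / 2 * (√(Q t) * (fourier (r : ℤ) t : ℂ).re) -
          a ^ 2 / 32 * (√(Q t) * (fourier ((2 * r : ℕ) : ℤ) t : ℂ).re))) ∂μ := by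
      refine integral_mono ?_ ?_ fun t => ?_
      · have hc : Continuous fun t => √(Q t * (1 + a * (fourier (r : ℤ) t : ℂ).re)) :=
          (hQc.mul (continuous_const.add (continuous_const.mul (meas_re_fourier r)))).sqrt
        obtain ⟨M'', hM''⟩ := bdd_of_cont hc
        exact integrable_of_bdd hc.measurable hM''
      · exact (hsi.const_mul _).add (((hmul _ _ hsi).const_mul _).sub ((hmul _ _ hsi).const_mul _))
      · simp only
        rw [Real.sqrt_mul (hQp t).le]
        have hx : |a * (fourier (r : ℤ) t : ℂ).re| ≤ 1 := by
          rw [abs_mul, abs_of_pos ha0]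
          nlinarith [abs_re_fourier r t, abs_nonneg (fourier (r : ℤ) t : ℂ).re]
        have := sqrt_aux hx
        have h2 := re_fourier_two r t
        push_cast
        rw [h2]
        have h3 := mul_le_mul_of_nonneg_left this (Real.sqrt_nonneg (Q t))
        refine h3.trans (le_of_eq ?_)
        ring
    refine hle.trans ?_
    have hi3 : Integrable (fun t => a / 2 * (√(Q t) * (fourier (r : ℤ) t : ℂ).re) -
          a ^ 2 / 32 * (√(Q t) * (fourier ((2 * r : ℕ) : ℤ) t : ℂ).re)) μ :=
      ((hmul _ _ hsi).const_mul _).sub ((hmul _ _ hsi).const_mul _)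
    rw [integral_add (hsi.const_mul _) hi3, integral_sub ((hmul _ _ hsi).const_mul _)
      ((hmul _ _ hsi).const_mul _), integral_const_mul, integral_const_mul, integral_const_mul]
    linarith
  · have hi1 : Integrable (fun t => B.indicator (fun _ => lam) t + Bᶜ.indicator Q t) μ :=
      ((integrable_const lam).indicator hB).add (integrable_of_bdd hindm hindb)
    have hi2 := hmul _ (r : ℤ) (integrable_of_bdd hindm hindb)
    have : ∫ t, (B.indicator (fun _ => lam) t + Bᶜ.indicator
        (fun t => Q t * (1 + a * (fourier (r : ℤ) t : ℂ).re)) t) ∂μ =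
        ∫ t, ((B.indicator (fun _ => lam) t + Bᶜ.indicator Q t) +
          a * (Bᶜ.indicator Q t * (fourier (r : ℤ) t : ℂ).re)) ∂μ := by
      refine integral_congr_ae (Eventually.of_forall fun t => ?_)
      by_cases h : t ∈ B
      · simp [h]
      · simp [h]; ring
    rw [this, integral_add hi1 (hi2.const_mul a), integral_const_mul]
    linarith

lemma St_succ {g : ℤ →₀ ℂ} {N : ℤ} {lam G δ : ℝ} (hlam : 1 ≤ lam) (hG1 : 1 ≤ G)
    (hG : ∀ A t, ‖T A t g‖ ≤ G) {a : ℕ → ℝ} (ha : ∀ j, 0 < a j ∧ a j ≤ 1 / 2)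
    (haδ : ∀ j, lam * G * (a j * (3 + ∑ i ∈ Finset.range j, a i)) ≤ δ) {j : ℕ} {D : ℤ}
    {R : ℤ →₀ ℂ} {Q : AddCircle (2 * π) → ℝ} {B : Set (AddCircle (2 * π))}
    (h : St g N lam G δ a j D R Q B) : ∃ D' R' Q' B', St g N lam G δ a (j + 1) D' R' Q' B' := by
  obtain ⟨D0, ND, gD, RD, coeff, Qc, Qpos, eval, sq, Bm, W, Qle, H, S⟩ := h
  obtain ⟨ha0, ha1⟩ := ha j
  obtain ⟨r, hr, hr1, hr2⟩ := choose_r hlam ha0 ha1 Qc Qpos Bm W (2 * D + 1).toNat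
  have hr' : 2 * D + 1 < (r : ℤ) := by omega
  set Q' : AddCircle (2 * π) → ℝ := fun t => Q t * (1 + a j * (fourier (r : ℤ) t : ℂ).re) with hQ'
  have hQ'c : Continuous Q' :=
    Qc.mul (continuous_const.add (continuous_const.mul (meas_re_fourier r)))
  have hQ'p : ∀ t, 0 < Q' t := fun t => by
    have := abs_le.1 (abs_re_fourier r t)
    exact mul_pos (Qpos t) (by nlinarith)
  have hsum : 0 ≤ ∑ i ∈ Finset.range j, a i := Finset.sum_nonneg fun i _ => (ha i).1.le
  have hlG : 1 ≤ lam * G := by nlinarith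
  have hB'm : MeasurableSet {t | lam < Q' t} := measurableSet_lt measurable_const hQ'c.measurable
  have hv : ∀ t, t ∉ B → ‖T Set.univ t R‖ ≤ lam * ‖T Set.univ t g‖ := fun t ht => by
    rw [eval, norm_mul, Complex.norm_real, Real.norm_of_nonneg (Qpos t).le, mul_comm]
    exact mul_le_mul_of_nonneg_right (Qle t ht) (norm_nonneg _)
  refine ⟨D + r, step (a j) r R, Q', B ∪ {t | lam < Q' t}, ?_⟩
  refine ⟨by omega, by omega, fun k hk => (gD k hk).trans (by omega),
    fun k hk => step_supp D0 RD hr' k hk, fun k hk => ?_, hQ'c, hQ'p, fun t => ?_, ?_,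
    Bm.union hB'm, ?_, fun t ht => ?_, fun t ht m => ?_, fun t ht n => ?_⟩
  · rw [step_coeff RD hr' k (by omega), coeff k hk]
  · rw [T_step_univ, eval, hQ']; push_cast; ring
  · refine hr1.trans ?_
    rw [Finset.prod_range_succ, mul_comm]
    refine mul_le_mul_of_nonneg_right sq ?_
    nlinarith
  · refine lt_of_le_of_lt (integral_mono ?_ ?_ fun t => ?_) hr2
    · obtain ⟨M, hM⟩ := bdd_of_cont hQ'c
      exact ((integrable_const lam).indicator (Bm.union hB'm)).add
        ((integrable_of_bdd hQ'c.measurable hM).indicator (Bm.union hB'm).compl)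
    · obtain ⟨M, hM⟩ := bdd_of_cont hQ'c
      exact ((integrable_const lam).indicator Bm).add
        ((integrable_of_bdd hQ'c.measurable hM).indicator Bm.compl)
    · simp only
      by_cases h1 : t ∈ B
      · simp [h1]
      · by_cases h2 : lam < Q' t
        · have : t ∈ B ∪ {t | lam < Q' t} := Or.inr h2
          simp only [Set.indicator, this, h1, Set.mem_compl_iff, if_true, if_false, not_true,
            not_false_eq_true]
          linarith
        · have : t ∉ B ∪ {t | lam < Q' t} := fun h => h.elim h1 h2
          simp only [Set.indicator, this, h1, Set.mem_compl_iff, if_true, if_false,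
            not_false_eq_true]
          exact le_rfl
  · by_contra hcon
    exact ht (Or.inr (not_le.1 hcon))
  · have htB : t ∉ B := fun h => ht (Or.inl h)
    have hvG : ‖T Set.univ t R‖ ≤ lam * G :=
      (hv t htB).trans (mul_le_mul_of_nonneg_left (hG _ _) (by linarith))
    rw [Finset.sum_range_succ]
    refine step_H D0 RD hr' ha0.le (by linarith) t hvG (H t htB) ?_ ?_ m
    · nlinarith
    · have : (1 + a j / 2) + a j / 2 * (3 + ∑ i ∈ Finset.range j, a i) ≤
          3 + (∑ i ∈ Finset.range j, a i + a j) := by nlinarith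
      have := mul_le_mul_of_nonneg_left this (by linarith : 0 ≤ lam * G)
      linarith
  · have htB : t ∉ B := fun h => ht (Or.inl h)
    rw [map_sub]
    rcases le_or_gt n D with hn | hn
    · rw [step_S_small RD hr' t hn, ← map_sub]
      exact S t htB n
    · have z : T {k | |k| ≤ n} t g = T Set.univ t g := by
        apply T_congr; intro k hk
        have := gD k hk; simp; omega
      have h1 := step_S_large D0 RD hr' ha0.le t (hv t htB) (H t htB) hn.le
      have h2 := hv t htB
      have h3 := haδ j
      rw [z]
      have h4 : ‖T Set.univ t g - T {k | |k| ≤ n} t (step (a j) r R)‖ ≤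
          ‖T Set.univ t g‖ + ‖T Set.univ t R‖ +
          ‖T {k | |k| ≤ n} t (step (a j) r R) - T Set.univ t R‖ := by
        have : T Set.univ t g - T {k | |k| ≤ n} t (step (a j) r R) =
          T Set.univ t g - T Set.univ t R -
            (T {k | |k| ≤ n} t (step (a j) r R) - T Set.univ t R) := by ring
        rw [this]
        exact (norm_sub_le _ _).trans (add_le_add_left (norm_sub_le _ _) _)
      have h5 : a j / 2 * (lam * ‖T Set.univ t g‖) ≤ lam * ‖T Set.univ t g‖ := by
        have : 0 ≤ lam * ‖T Set.univ t g‖ := by positivity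
        nlinarith
      nlinarith

lemma key (g : ℤ →₀ ℂ) (N : ℤ) {lam δ : ℝ} (hlam : 1 ≤ lam) (hδ : 0 < δ) :
    ∃ (P : ℤ →₀ ℂ) (E : Set (AddCircle (2 * π))), (∀ k, |k| ≤ N → P k = 0) ∧
      μ.real E ≤ 3 / lam ∧ ∀ t, t ∉ E → ‖T Set.univ t P - T Set.univ t g‖ ≤ δ ∧
        ∀ n : ℤ, ‖T {k | |k| ≤ n} t P‖ ≤ (1 + 2 * lam) * ‖T Set.univ t g‖ + δ := by
  obtain ⟨G, hG1, hG⟩ := T_bound g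
  have hlG : 0 < lam * G := by positivity
  obtain ⟨a, ha, ha2, ha3⟩ := exists_seq (show 0 < δ / (lam * G) by positivity)
  have haδ : ∀ j, lam * G * (a j * (3 + ∑ i ∈ Finset.range j, a i)) ≤ δ := fun j => by
    have := ha2 j
    rw [le_div_iff₀ hlG] at this
    linarith
  have hex : ∀ j, ∃ D R Q B, St g N lam G δ a j D R Q B := fun j => by
    induction j with
    | zero => obtain ⟨D, h⟩ := St_zero g N hlam hδ.le hG1 hG a; exact ⟨_, _, _, _, h⟩
    | succ j ih => obtain ⟨D, R, Q, B, h⟩ := ih; exact St_succ hlam hG1 hG ha haδ h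
  set η := δ / G with hη
  have hη0 : 0 < η := by positivity
  obtain ⟨J, hJ⟩ := (ha3.eventually_lt_const (show 0 < √η / lam by positivity)).exists
  obtain ⟨D, R, Q, B, D0, ND, gD, RD, coeff, Qc, Qpos, eval, sq, Bm, W, Qle, H, S⟩ := hex J
  refine ⟨g - R, B ∪ {t | √η ≤ √(Q t)}, fun k hk => by simp [coeff k hk], ?_, fun t ht => ⟨?_, ?_⟩⟩
  · obtain ⟨M, hM⟩ := bdd_of_cont Qc
    obtain ⟨M', hM'⟩ := bdd_of_cont Qc.sqrt
    have h1 : μ.real {t | √η ≤ √(Q t)} ≤ 1 / lam := by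
      have := mul_meas_ge_le_integral_of_nonneg (μ := μ)
        (Eventually.of_forall fun t => Real.sqrt_nonneg (Q t))
        (integrable_of_bdd Qc.sqrt.measurable hM') (√η)
      have h3 : √η * μ.real {t | √η ≤ √(Q t)} ≤ √η * (1 / lam) := by
        rw [mul_one_div]; linarith
      exact le_of_mul_le_mul_left h3 (by positivity)
    have h2 : μ.real B ≤ 2 / lam := by
      have hle : ∫ t, B.indicator (fun _ => lam) t ∂μ ≤
          ∫ t, (B.indicator (fun _ => lam) t + Bᶜ.indicator Q t) ∂μ := by
        refine integral_mono ((integrable_const lam).indicator Bm)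
          (((integrable_const lam).indicator Bm).add
          ((integrable_of_bdd Qc.measurable hM).indicator Bm.compl)) fun t => ?_
        have : 0 ≤ Bᶜ.indicator Q t := Set.indicator_nonneg (fun t _ => (Qpos t).le) t
        simp only
        linarith
      rw [integral_indicator_const lam Bm, smul_eq_mul] at hle
      rw [le_div_iff₀ (by linarith)]
      linarith
    refine (measureReal_union_le _ _).trans ?_
    have : 3 / lam = 2 / lam + 1 / lam := by ring
    linarith
  · have hq : √(Q t) < √η := by
      by_contra hcon; exact ht (Or.inr (not_lt.1 hcon))
    have hq' : Q t < η := (Real.sqrt_lt_sqrt_iff (Qpos t).le).1 hq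
    rw [map_sub, sub_sub_cancel_left, norm_neg, eval, norm_mul, Complex.norm_real,
      Real.norm_of_nonneg (Qpos t).le]
    have h1 := hG Set.univ t
    have : η * G = δ := by rw [hη]; field_simp
    nlinarith [norm_nonneg (T Set.univ t g), Qpos t]
  · exact S t fun h => ht (Or.inl h)


lemma approx {f : AddCircle (2 * π) → ℂ} (hf : Measurable f) {δ ε : ℝ} (hδ : 0 < δ) (hε : 0 < ε) :
    ∃ (g : ℤ →₀ ℂ) (E : Set (AddCircle (2 * π))), μ.real E ≤ ε ∧
      ∀ t, t ∉ E → ‖f t - T Set.univ t g‖ ≤ δ := by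
  have htr : Tendsto (fun n : ℕ => μ.real {t | (n : ℝ) < ‖f t‖}) atTop (𝓝 0) := by
    have h1 : Tendsto (fun n : ℕ => μ {t | (n : ℝ) < ‖f t‖}) atTop
        (𝓝 (μ (⋂ n : ℕ, {t | (n : ℝ) < ‖f t‖}))) := by
      refine tendsto_measure_iInter_atTop
        (fun n => (measurableSet_lt measurable_const hf.norm).nullMeasurableSet) ?_
        ⟨0, measure_ne_top _ _⟩
      intro m n hmn t ht
      exact lt_of_le_of_lt (Nat.cast_le.2 hmn : (m : ℝ) ≤ n) (show (n : ℝ) < ‖f t‖ from ht)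
    have h2 : (⋂ n : ℕ, {t | (n : ℝ) < ‖f t‖}) = ∅ := by
      ext t
      simp only [Set.mem_iInter, Set.mem_empty_iff_false, iff_false, not_forall]
      obtain ⟨n, hn⟩ := exists_nat_ge ‖f t‖
      exact ⟨n, fun h => absurd hn (not_le.2 h)⟩
    rw [h2, measure_empty] at h1
    exact (ENNReal.tendsto_toReal ENNReal.zero_ne_top).comp h1
  obtain ⟨n, hn⟩ := (htr.eventually_lt_const (half_pos hε)).exists
  have hAm : MeasurableSet {t | (n : ℝ) < ‖f t‖}ᶜ :=
    (measurableSet_lt measurable_const hf.norm).compl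
  set f' := Set.indicator {t | (n : ℝ) < ‖f t‖}ᶜ f with hf'
  have hi : Integrable f' μ := by
    refine Integrable.of_bound (hf.indicator hAm).aestronglyMeasurable n
      (Eventually.of_forall fun t => ?_)
    by_cases h : t ∈ {t | (n : ℝ) < ‖f t‖}ᶜ
    · rw [hf', Set.indicator_of_mem h]; exact not_lt.1 h
    · rw [hf', Set.indicator_of_notMem h]; simp
  obtain ⟨u, hu, hui⟩ := hi.exists_boundedContinuous_integral_sub_le
    (show 0 < δ / 2 * (ε / 2) by positivity)
  let U : C(AddCircle (2 * π), ℂ) := u.toContinuousMap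
  have hU : U ∈ (Submodule.span ℂ (Set.range <| @fourier (2 * π))).topologicalClosure := by
    rw [span_fourier_closure_eq_top]; trivial
  rw [← SetLike.mem_coe, Submodule.topologicalClosure_coe, Metric.mem_closure_iff] at hU
  obtain ⟨p, hp, hpd⟩ := hU (δ / 2) (half_pos hδ)
  obtain ⟨g, hg⟩ := Finsupp.mem_span_range_iff_exists_finsupp.1 hp
  have hgp : ∀ t, T Set.univ t g = p t := fun t => by
    rw [← hg, T_apply, Finsupp.sum]
    simp [ContinuousMap.sum_apply]
  refine ⟨g, {t | (n : ℝ) < ‖f t‖} ∪ {t | δ / 2 ≤ ‖f' t - u t‖}, ?_, fun t ht => ?_⟩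
  · refine (measureReal_union_le _ _).trans ?_
    have := mul_meas_ge_le_integral_of_nonneg (μ := μ)
        (Eventually.of_forall fun t => norm_nonneg (f' t - u t)) (hi.sub hui).norm (δ / 2)
    have h3 := le_of_mul_le_mul_left (this.trans hu) (half_pos hδ)
    linarith
  · have h1 : t ∈ {t | (n : ℝ) < ‖f t‖}ᶜ := fun h => ht (Or.inl h)
    have h2 : ‖f' t - u t‖ < δ / 2 := by
      by_contra hcon; exact ht (Or.inr (not_lt.1 hcon))
    rw [hf', Set.indicator_of_mem h1] at h2
    have h3 : ‖u t - p t‖ ≤ δ / 2 := by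
      rw [← dist_eq_norm]
      exact (ContinuousMap.dist_apply_le_dist (f := U) (g := p) t).trans hpd.le
    rw [hgp]
    have := norm_sub_le_norm_sub_add_norm_sub (f t) (u t) (p t)
    linarith

lemma key2 {f : AddCircle (2 * π) → ℂ} (hf : Measurable f) (N : ℤ) {lam δ : ℝ}
    (hlam : 1 ≤ lam) (hδ : 0 < δ) :
    ∃ (P : ℤ →₀ ℂ) (E : Set (AddCircle (2 * π))) (M : ℤ), N < M ∧ (∀ k, |k| ≤ N → P k = 0) ∧
      (∀ k, P k ≠ 0 → |k| ≤ M) ∧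
      μ.real E ≤ 4 / lam ∧ ∀ t, t ∉ E → ‖f t - T Set.univ t P‖ ≤ δ ∧
        ∀ n : ℤ, ‖T {k | |k| ≤ n} t P‖ ≤ (1 + 2 * lam) * ‖f t‖ + δ := by
  obtain ⟨δ', hδ0, hδ1⟩ : ∃ δ' : ℝ, 0 < δ' ∧ (2 + 2 * lam) * δ' = δ :=
    ⟨δ / (2 + 2 * lam), by positivity, by field_simp⟩
  obtain ⟨g, E₁, hE₁, h1⟩ := approx hf hδ0 (show 0 < 1 / lam by positivity)
  obtain ⟨P, E₂, hP, hE₂, h2⟩ := key g N hlam hδ0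
  obtain ⟨D, hD⟩ : ∃ D : ℤ, ∀ k, P k ≠ 0 → |k| ≤ D := by
    refine ⟨∑ k ∈ P.support, |k|, fun k hk => ?_⟩
    exact Finset.single_le_sum (f := fun k : ℤ => |k|) (fun _ _ => abs_nonneg _)
      (by simpa using hk)
  refine ⟨P, E₁ ∪ E₂, max D (N + 1), by simp, hP, fun k hk => (hD k hk).trans (by simp), ?_,
    fun t ht => ?_⟩
  · refine (measureReal_union_le _ _).trans ?_
    have : 4 / lam = 1 / lam + 3 / lam := by ring
    linarith
  · have a1 := h1 t fun h => ht (Or.inl h)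
    obtain ⟨a2, a3⟩ := h2 t fun h => ht (Or.inr h)
    constructor
    · have := norm_sub_le_norm_sub_add_norm_sub (f t) (T Set.univ t g) (T Set.univ t P)
      rw [norm_sub_rev] at a2
      nlinarith
    · intro n
      refine (a3 n).trans ?_
      have : ‖T Set.univ t g‖ ≤ ‖f t‖ + δ' := by
        have := norm_sub_norm_le (T Set.univ t g) (f t)
        rw [norm_sub_rev] at this
        linarith
      nlinarith

lemma partialSum_eq {c : ℤ → ℂ} {F : ℤ →₀ ℂ} {K : ℕ} (h : ∀ k : ℤ, |k| ≤ K → c k = F k)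
    (t : AddCircle (2 * π)) :
    menshovPartialSum Set.univ c K t = T {k | |k| ≤ (K : ℤ)} t F := by
  rw [menshovPartialSum, T_apply]
  have h1 : ∀ k : ℤ, k ∈ Finset.Icc (-(K : ℤ)) K ↔ |k| ≤ K := fun k => by
    rw [Finset.mem_Icc, abs_le]
  rw [Finset.sum_subset (Finset.subset_union_left (s₂ := Finset.Icc (-(K : ℤ)) K)
      (s₁ := F.support)),
    ← Finset.sum_subset (Finset.subset_union_right (s₂ := Finset.Icc (-(K : ℤ)) K)
      (s₁ := F.support))]
  · refine Finset.sum_congr rfl fun k hk => ?_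
    have hk' := (h1 k).1 hk
    rw [Set.indicator_of_mem (Set.mem_univ k), h k hk', Set.indicator_of_mem (by exact hk')]
  · intro k _ hk
    rw [Set.indicator_of_notMem, mul_zero]
    exact fun h => hk ((h1 k).2 h)
  · intro k _ hk
    rw [Finsupp.notMem_support_iff.1 hk, zero_mul]

lemma main_rep (f : AddCircle (2 * π) → ℂ) (hf : Measurable f) : ∃ c : ℤ → ℂ,
    ∀ᵐ t ∂μ, Tendsto (fun N => menshovPartialSum Set.univ c N t) atTop (𝓝 (f t)) := by
  have hstep : ∀ (n : ℕ) (F : ℤ →₀ ℂ) (N : ℤ), ∃ (P : ℤ →₀ ℂ) (E : Set (AddCircle (2 * π)))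
      (M : ℤ), N < M ∧ (∀ k, |k| ≤ N → P k = 0) ∧ (∀ k, P k ≠ 0 → |k| ≤ M) ∧
      μ.real E ≤ 4 / 2 ^ n ∧ ∀ t, t ∉ E →
        ‖(f t - T Set.univ t F) - T Set.univ t P‖ ≤ (1 / 8) ^ n ∧
        ∀ m : ℤ, ‖T {k | |k| ≤ m} t P‖ ≤
          (1 + 2 * 2 ^ n) * ‖f t - T Set.univ t F‖ + (1 / 8) ^ n :=
    fun n F N => key2 (hf.sub (continuous_T _ F).measurable) N
      (one_le_pow₀ (by norm_num)) (by positivity)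
  choose P E M hM hP0 hPM hE hPE using hstep
  let s : ℕ → (ℤ →₀ ℂ) × ℤ := fun n => Nat.rec (0, 0)
    (fun n x => (x.1 + P n x.1 x.2, M n x.1 x.2)) n
  let F : ℕ → (ℤ →₀ ℂ) := fun n => (s n).1
  let N : ℕ → ℤ := fun n => (s n).2
  have F0 : F 0 = 0 := rfl
  have N0 : N 0 = 0 := rfl
  have Fs : ∀ n, F (n + 1) = F n + P n (F n) (N n) := fun n => rfl
  have Ns : ∀ n, N (n + 1) = M n (F n) (N n) := fun n => rfl
  have Nlt : ∀ n, N n < N (n + 1) := fun n => by rw [Ns]; exact hM _ _ _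
  have Nmono : StrictMono N := strictMono_nat_of_lt_succ Nlt
  have Nge : ∀ n : ℕ, (n : ℤ) ≤ N n := fun n => by
    induction n with
    | zero => simp [N0]
    | succ n ih => have := Nlt n; push_cast; omega
  have Fsupp : ∀ n k, F n k ≠ 0 → |k| ≤ N n := fun n => by
    induction n with
    | zero => intro k hk; simp [F0] at hk
    | succ n ih =>
      intro k hk
      by_cases h : F n k = 0
      · rw [Fs, Finsupp.add_apply, h, zero_add] at hk
        rw [Ns]; exact hPM _ _ _ k hk
      · exact (ih k h).trans (Nlt n).le
  have Fagree : ∀ n m k, n ≤ m → |k| ≤ N n → F m k = F n k := fun n m k hnm hk => by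
    induction m, hnm using Nat.le_induction with
    | base => rfl
    | succ m hm ih =>
      rw [Fs, Finsupp.add_apply, ih, hP0, add_zero]
      exact hk.trans (Nmono.monotone hm)
  let c : ℤ → ℂ := fun k => F k.natAbs k
  have hc : ∀ n k, |k| ≤ N n → c k = F n k := fun n k hk => by
    have h1 : |k| ≤ N k.natAbs := by
      have := Nge k.natAbs; rw [Int.natCast_natAbs] at this; exact this
    rw [← Fagree n (max n k.natAbs) k (le_max_left _ _) hk,
      Fagree k.natAbs (max n k.natAbs) k (le_max_right _ _) h1]
  let E' : ℕ → Set (AddCircle (2 * π)) := fun n => E n (F n) (N n)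
  have hsum : ∑' n, μ (E' n) ≠ ⊤ := by
    have hs : Summable fun n : ℕ => (4 : ℝ) / 2 ^ n := by
      have := (summable_geometric_two).mul_left 4
      refine this.congr fun n => ?_
      rw [one_div, inv_pow]; rfl
    have hle : ∀ n, μ (E' n) ≤ ENNReal.ofReal (4 / 2 ^ n) := fun n => by
      rw [← ENNReal.ofReal_toReal (measure_ne_top μ (E' n))]
      exact ENNReal.ofReal_le_ofReal (hE n (F n) (N n))
    refine ne_top_of_le_ne_top ?_ (ENNReal.tsum_le_tsum hle)
    exact hs.tsum_ofReal_ne_top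
  refine ⟨c, ?_⟩
  filter_upwards [ae_eventually_notMem hsum] with t ht
  obtain ⟨n0, hn0⟩ := eventually_atTop.1 ht
  have hres : ∀ n, n0 ≤ n → ‖f t - T Set.univ t (F (n + 1))‖ ≤ (1 / 8) ^ n := fun n hn => by
    have := (hPE n (F n) (N n) t (hn0 n hn)).1
    rw [Fs, map_add, ← sub_sub]; exact this
  have hb : ∀ n, n0 ≤ n → ∀ K : ℕ, N (n + 1) ≤ K → (K : ℤ) ≤ N (n + 2) →
      ‖menshovPartialSum Set.univ c K t - f t‖ ≤ 7 * (1 / 2) ^ n := fun n hn K hK1 hK2 => by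
    rw [partialSum_eq (fun k hk => hc (n + 2) k (hk.trans hK2)), Fs (n + 1), map_add]
    have z : T {k | |k| ≤ (K : ℤ)} t (F (n + 1)) = T Set.univ t (F (n + 1)) := by
      apply T_congr; intro k hk
      have := Fsupp (n + 1) k hk; simp; omega
    rw [z]
    have h1 := hres n hn
    have h2 := (hPE (n + 1) (F (n + 1)) (N (n + 1)) t (hn0 (n + 1) (by omega))).2 K
    set x := T Set.univ t (F (n + 1))
    set y := T {k | |k| ≤ (K : ℤ)} t (P (n + 1) (F (n + 1)) (N (n + 1)))
    have h3 : ‖x + y - f t‖ ≤ ‖f t - x‖ + ‖y‖ := by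
      rw [show x + y - f t = y - (f t - x) by ring, add_comm]
      exact norm_sub_le _ _
    have e1 : (2 : ℝ) ^ n * (1 / 8) ^ n = (1 / 4) ^ n := by rw [← mul_pow]; norm_num
    have e2 : ((1 : ℝ) / 4) ^ n ≤ (1 / 2) ^ n :=
      pow_le_pow_left₀ (by norm_num) (by norm_num) n
    have e3 : ((1 : ℝ) / 8) ^ n ≤ (1 / 2) ^ n :=
      pow_le_pow_left₀ (by norm_num) (by norm_num) n
    have h4 : (1 + 2 * 2 ^ (n + 1)) * ‖f t - x‖ ≤ (1 + 2 * 2 ^ (n + 1)) * (1 / 8) ^ n :=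
      mul_le_mul_of_nonneg_left h1 (by positivity)
    rw [pow_succ, pow_succ] at h2
    rw [pow_succ] at h4
    nlinarith [norm_nonneg (f t - x)]
  rw [Metric.tendsto_atTop]
  intro ε hε
  have hlim : Tendsto (fun n : ℕ => 7 * (1 / 2 : ℝ) ^ n) atTop (𝓝 0) := by
    simpa using (tendsto_pow_atTop_nhds_zero_of_lt_one (r := (1 / 2 : ℝ)) (by norm_num)
      (by norm_num)).const_mul 7
  obtain ⟨n1, hn1⟩ := eventually_atTop.1 (hlim.eventually_lt_const hε)
  refine ⟨(N (max n0 n1 + 1)).toNat, fun K hK => ?_⟩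
  have hK' : N (max n0 n1 + 1) ≤ K := by omega
  classical
  have hex : ∃ n, (K : ℤ) < N n := ⟨K + 1, by have := Nge (K + 1); push_cast at this; omega⟩
  have hf1 := Nat.find_spec hex
  have hf2 := fun m => Nat.find_min hex (m := m)
  generalize Nat.find hex = q at hf1 hf2
  have hq : max n0 n1 + 1 < q := Nmono.lt_iff_lt.1 (hK'.trans_lt hf1)
  obtain ⟨n, rfl⟩ : ∃ n, q = n + 2 := ⟨q - 2, by omega⟩
  have h5 : N (n + 1) ≤ K := not_lt.1 (hf2 (n + 1) (by omega))
  rw [dist_eq_norm]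
  exact (hb n (by omega) K h5 hf1.le).trans_lt (hn1 n (by omega))

end Menshov

/-- **Menshov's representation theorem**: every measurable function on the circle is the
a.e. limit of the symmetric partial sums of some trigonometric series; i.e. `ℤ` is a
Menshov spectrum. -/
theorem menshov_representation :
    IsMenshovSpectrum (Set.univ : Set ℤ) := by
  intro f hf
  obtain ⟨c, hc⟩ := Menshov.main_rep f hf
  refine ⟨c, ?_⟩
  rw [AddCircle.volume_eq_smul_haarAddCircle]
  exact Measure.ae_smul_measure hc _
end

section
/- For every positive sequence ε(n) with ε(n) → 0 as n → ∞, there exists a Menshov spectrum Λ ⊆ ℤ, enumerated in increasing order as Λ = {λ(n) : n ∈ ℤ} with … < λ(−1) < λ(0) < λ(1) < …, λ(n) > 0 for n ≥ 1 and λ(−n) < 0 for n ≥ 1, such that λ(n+1)/λ(n) > 1 + ε(n) and λ(−n−1)/λ(−n) > 1 + ε(n) for all n = 1, 2, …. In particular, a Menshov spectrum can be lacunary with gap ratios arbitrarily close to Hadamard lacunarity. -/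
open MeasureTheory Filter Topology Real

/-! ### Fejér kernel estimates -/

/-- Dirichlet kernel in the variable `w`. -/
noncomputable def dirK (w : ℂ) (j : ℕ) : ℂ :=
  1 + ∑ r ∈ Finset.range j, (w ^ (r + 1) + w⁻¹ ^ (r + 1))

/-- Fejér coefficients. -/
noncomputable def fejC (n k : ℕ) : ℝ := 1 - (k : ℝ) / (n + 1)

/-- Truncated Fejér kernel. -/
noncomputable def fejK (n : ℕ) (w : ℂ) (V : ℕ) : ℂ :=
  1 + ∑ r ∈ Finset.range V, (fejC n (r + 1) : ℂ) * (w ^ (r + 1) + w⁻¹ ^ (r + 1))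

lemma dirK_mul (w : ℂ) (hw : ‖w‖ = 1) (j : ℕ) :
    (w - 1) * dirK w j = w ^ (j + 1) - w⁻¹ ^ j := by
  have hw0 : w ≠ 0 := by
    intro h; simp [h] at hw
  induction j with
  | zero => simp [dirK]
  | succ j ih =>
    have : dirK w (j + 1) = dirK w j + (w ^ (j + 1) + w⁻¹ ^ (j + 1)) := by
      simp only [dirK, Finset.sum_range_succ]; ring
    rw [this, mul_add, ih]
    have h1 : w * w⁻¹ = 1 := mul_inv_cancel₀ hw0
    have h2 : w * w⁻¹ ^ (j + 1) = w⁻¹ ^ j := by rw [pow_succ']; rw [← mul_assoc, h1, one_mul]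
    linear_combination h2

lemma dirK_norm (w : ℂ) (hw : ‖w‖ = 1) (j : ℕ) : ‖w - 1‖ * ‖dirK w j‖ ≤ 2 := by
  rw [← norm_mul, dirK_mul w hw]
  refine (norm_sub_le _ _).trans ?_
  simp [hw]; norm_num

lemma fejK_eq (n : ℕ) (w : ℂ) (V : ℕ) :
    fejK n w V = (fejC n V : ℂ) * dirK w V + (1 / (n + 1) : ℂ) * ∑ j ∈ Finset.range V, dirK w j := by
  induction V with
  | zero => simp [fejK, fejC, dirK]
  | succ V ih =>
    have h1 : dirK w (V + 1) = dirK w V + (w ^ (V + 1) + w⁻¹ ^ (V + 1)) := by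
      simp only [dirK, Finset.sum_range_succ]; ring
    have h2 : fejK n w (V + 1) = fejK n w V +
        (fejC n (V + 1) : ℂ) * (w ^ (V + 1) + w⁻¹ ^ (V + 1)) := by
      simp only [fejK, Finset.sum_range_succ]; ring
    have h3 : (fejC n V : ℂ) = fejC n (V + 1) + 1 / (n + 1) := by
      simp only [fejC]; push_cast; ring
    rw [h2, h1, ih, Finset.sum_range_succ, h3]
    ring

lemma fejC_nonneg (n k : ℕ) (h : k ≤ n + 1) : 0 ≤ fejC n k := by
  have : (k : ℝ) ≤ n + 1 := by exact_mod_cast h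
  simp only [fejC, sub_nonneg]
  rw [div_le_one (by positivity)]; exact this

lemma fejC_le_one (n k : ℕ) : fejC n k ≤ 1 := by
  have : 0 ≤ (k : ℝ) / (n + 1) := by positivity
  simp only [fejC]; linarith

lemma fejK_trunc_norm (n : ℕ) (w : ℂ) (hw : ‖w‖ = 1) (V : ℕ) (hV : V ≤ n + 1) :
    ‖w - 1‖ * ‖fejK n w V‖ ≤ 2 := by
  rw [fejK_eq]
  have h0 := fejC_nonneg n V hV
  have hn : (0 : ℝ) < n + 1 := by positivity
  calc ‖w - 1‖ * ‖(fejC n V : ℂ) * dirK w V + (1 / (n + 1) : ℂ) * ∑ j ∈ Finset.range V, dirK w j‖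
      ≤ ‖w - 1‖ * (fejC n V * ‖dirK w V‖ + (1 / (n + 1)) * ∑ j ∈ Finset.range V, ‖dirK w j‖) := by
        gcongr
        refine (norm_add_le _ _).trans ?_
        rw [norm_mul, norm_mul]
        have e1 : ‖(fejC n V : ℂ)‖ = fejC n V := by
          rw [Complex.norm_real, Real.norm_of_nonneg h0]
        have e2 : ‖(1 / (n + 1) : ℂ)‖ = 1 / (n + 1) := by
          rw [show (1 / (n + 1) : ℂ) = ((1 / (n + 1) : ℝ) : ℂ) by push_cast; rfl, Complex.norm_real,
            Real.norm_of_nonneg (by positivity)]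
        rw [e1, e2]
        gcongr
        exact norm_sum_le _ _
    _ = fejC n V * (‖w - 1‖ * ‖dirK w V‖) +
          (1 / (n + 1)) * ∑ j ∈ Finset.range V, ‖w - 1‖ * ‖dirK w j‖ := by
        rw [← Finset.mul_sum]; ring
    _ ≤ fejC n V * 2 + (1 / (n + 1)) * ∑ j ∈ Finset.range V, 2 := by
        gcongr
        · exact dirK_norm w hw V
        · exact dirK_norm w hw _
    _ = 2 := by
        simp [fejC]; field_simp; ring

lemma fejK_full_norm (n : ℕ) (w : ℂ) (hw : ‖w‖ = 1) :
    ‖w - 1‖ ^ 2 * ‖fejK n w n‖ ≤ 4 / (n + 1) := by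
  have hw0 : w ≠ 0 := by
    intro h; simp [h] at hw
  have h1 : w * w⁻¹ = 1 := mul_inv_cancel₀ hw0
  have hs : ∀ V : ℕ, (w - 1) ^ 2 * ∑ j ∈ Finset.range V, dirK w j =
      w ^ (V + 1) - w - w + w * w⁻¹ ^ V := by
    intro V
    induction V with
    | zero => simp
    | succ V ih =>
      rw [Finset.sum_range_succ, mul_add, ih, sq, mul_assoc, dirK_mul w hw]
      have h2 : w * w⁻¹ ^ (V + 1) = w⁻¹ ^ V := by rw [pow_succ']; rw [← mul_assoc, h1, one_mul]
      linear_combination -h2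
  have he : fejK n w n = (1 / (n + 1) : ℂ) * ∑ j ∈ Finset.range (n + 1), dirK w j := by
    rw [fejK_eq, Finset.sum_range_succ]
    have : (fejC n n : ℂ) = 1 / (n + 1) := by
      have : (n + 1 : ℂ) ≠ 0 := by exact_mod_cast Nat.succ_ne_zero n
      simp only [fejC]; push_cast; field_simp; ring
    rw [this]; ring
  have e2 : ‖(1 / (n + 1) : ℂ)‖ = 1 / (n + 1) := by
    rw [show (1 / (n + 1) : ℂ) = ((1 / (n + 1) : ℝ) : ℂ) by push_cast; rfl, Complex.norm_real,
      Real.norm_of_nonneg (by positivity)]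
  rw [← norm_pow, ← norm_mul, he, mul_left_comm, hs, norm_mul, e2]
  have : ‖w ^ (n + 1 + 1) - w - w + w * w⁻¹ ^ (n + 1)‖ ≤ 4 := by
    refine (norm_add_le _ _).trans ?_
    have a1 := norm_sub_le (w ^ (n + 1 + 1) - w) w
    have a2 := norm_sub_le (w ^ (n + 1 + 1)) w
    simp only [norm_mul, norm_pow, norm_inv, hw, one_pow, inv_one, mul_one] at *
    linarith
  calc _ ≤ 1 / ((n : ℝ) + 1) * 4 := by gcongr
    _ = _ := by ring

/-! ### Trigonometric polynomials -/

/-- Evaluation of a trigonometric polynomial. -/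
noncomputable def tev (t : AddCircle (2 * π)) : (ℤ →₀ ℂ) →ₗ[ℂ] ℂ :=
  Finsupp.linearCombination ℂ (fun k => (fourier k t : ℂ))

/-- Partial sums of a trigonometric polynomial. -/
noncomputable def tps (N : ℕ) (t : AddCircle (2 * π)) : (ℤ →₀ ℂ) →ₗ[ℂ] ℂ :=
  Finsupp.linearCombination ℂ (fun k => if |k| ≤ (N : ℤ) then (fourier k t : ℂ) else 0)

/-- Shift of the spectrum. -/
noncomputable def tsh (a : ℤ) : (ℤ →₀ ℂ) →ₗ[ℂ] (ℤ →₀ ℂ) :=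
  Finsupp.lmapDomain ℂ ℂ (fun k => k + a)

/-- Multiplication by `1 - K_n(W t)`. -/
noncomputable def mop (n : ℕ) (W : ℤ) (q : ℤ →₀ ℂ) : ℤ →₀ ℂ :=
  ∑ r ∈ Finset.range n, (-(fejC n (r + 1) : ℂ)) •
    (tsh (((r : ℤ) + 1) * W) q + tsh (-(((r : ℤ) + 1) * W)) q)

/-- `B` bounds the sum of absolute values of coefficients. -/
def TBd (q : ℤ →₀ ℂ) (B : ℝ) : Prop :=
  ∀ φ : ℤ → ℂ, (∀ k, ‖φ k‖ ≤ 1) → ‖Finsupp.linearCombination ℂ φ q‖ ≤ B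

lemma fourier_norm_one (k : ℤ) (t : AddCircle (2 * π)) : ‖(fourier k t : ℂ)‖ = 1 := by
  rw [fourier_apply]; exact Circle.norm_coe _

lemma tev_tsh (t : AddCircle (2 * π)) (a : ℤ) (q : ℤ →₀ ℂ) :
    tev t (tsh a q) = fourier a t * tev t q := by
  induction q using Finsupp.induction_linear with
  | zero => simp
  | add f g hf hg => simp only [map_add, hf, hg, mul_add]
  | single k c =>
    simp only [tsh, tev, Finsupp.lmapDomain_apply, Finsupp.mapDomain_single,
      Finsupp.linearCombination_single, fourier_add, smul_eq_mul]
    ring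

lemma fourier_pow (k : ℕ) (W : ℤ) (t : AddCircle (2 * π)) :
    (fourier (((k : ℤ) + 1) * W) t : ℂ) = (fourier W t : ℂ) ^ (k + 1) := by
  induction k with
  | zero => simp
  | succ k ih =>
    rw [pow_succ, ← ih, ← fourier_add]; congr 2; push_cast; ring

lemma fourier_inv (W : ℤ) (t : AddCircle (2 * π)) :
    (fourier (-W) t : ℂ) = (fourier W t : ℂ)⁻¹ := by
  have h : (fourier W t : ℂ) * fourier (-W) t = 1 := by rw [← fourier_add]; simp
  exact eq_inv_of_mul_eq_one_right h

lemma fourier_pow_neg (k : ℕ) (W : ℤ) (t : AddCircle (2 * π)) :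
    (fourier (-(((k : ℤ) + 1) * W)) t : ℂ) = (fourier W t : ℂ)⁻¹ ^ (k + 1) := by
  rw [fourier_inv, fourier_pow, inv_pow]

lemma tev_mop (t : AddCircle (2 * π)) (n : ℕ) (W : ℤ) (q : ℤ →₀ ℂ) :
    tev t (mop n W q) = (1 - fejK n (fourier W t) n) * tev t q := by
  simp only [mop, map_sum, map_smul, map_add, tev_tsh, fourier_pow, fourier_pow_neg, fejK,
    smul_eq_mul]
  rw [sub_add_cancel_left, neg_mul, Finset.sum_mul, ← Finset.sum_neg_distrib]
  refine Finset.sum_congr rfl fun r _ => by ring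

lemma tps_eq_tev (N : ℕ) (t : AddCircle (2 * π)) (q : ℤ →₀ ℂ)
    (h : ∀ k ∈ q.support, |k| ≤ (N : ℤ)) : tps N t q = tev t q := by
  simp only [tps, tev, Finsupp.linearCombination_apply, Finsupp.sum]
  exact Finset.sum_congr rfl fun k hk => by rw [if_pos (h k hk)]

lemma tps_eq_zero (N : ℕ) (t : AddCircle (2 * π)) (q : ℤ →₀ ℂ)
    (h : ∀ k ∈ q.support, (N : ℤ) < |k|) : tps N t q = 0 := by
  simp only [tps, Finsupp.linearCombination_apply, Finsupp.sum]
  exact Finset.sum_eq_zero fun k hk => by rw [if_neg (not_le.2 (h k hk)), smul_zero]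

lemma tsh_support (a : ℤ) (q : ℤ →₀ ℂ) (k : ℤ) (hk : k ∈ (tsh a q).support) :
    ∃ b ∈ q.support, k = b + a := by
  have := Finsupp.mapDomain_support hk
  simp only [Finset.mem_image] at this
  obtain ⟨b, hb, h⟩ := this
  exact ⟨b, hb, h.symm⟩

lemma mop_support (n : ℕ) (W : ℤ) (q : ℤ →₀ ℂ) (k : ℤ) (hk : k ∈ (mop n W q).support) :
    ∃ b ∈ q.support, ∃ r : ℤ, r ≠ 0 ∧ |r| ≤ n ∧ k = b + r * W := by
  have h1 := Finsupp.support_finsetSum hk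
  simp only [Finset.mem_biUnion, Finset.mem_range] at h1
  obtain ⟨r, hr, h2⟩ := h1
  have h3 := Finsupp.support_add (Finsupp.support_smul h2)
  rcases Finset.mem_union.1 h3 with h | h
  · obtain ⟨b, hb, e⟩ := tsh_support _ _ _ h
    exact ⟨b, hb, r + 1, by omega, by rw [abs_of_nonneg] <;> omega, e⟩
  · obtain ⟨b, hb, e⟩ := tsh_support _ _ _ h
    refine ⟨b, hb, -(r + 1), by omega, by rw [abs_neg, abs_of_nonneg] <;> omega, ?_⟩
    rw [e]; ring

lemma TBd_tps {q : ℤ →₀ ℂ} {B : ℝ} (h : TBd q B) (N : ℕ) (t : AddCircle (2 * π)) (a : ℤ) :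
    ‖tps N t (tsh a q)‖ ≤ B := by
  have : tps N t (tsh a q) = Finsupp.linearCombination ℂ
      ((fun k => if |k| ≤ (N : ℤ) then (fourier k t : ℂ) else 0) ∘ fun k => k + a) q := by
    simp only [tps, tsh, Finsupp.lmapDomain_apply, Finsupp.linearCombination_mapDomain]
  rw [this]
  refine h _ fun k => ?_
  simp only [Function.comp]
  split_ifs
  · rw [fourier_norm_one]
  · simp

lemma TBd_mop {q : ℤ →₀ ℂ} {B : ℝ} (h : TBd q B) (n : ℕ) (W : ℤ) :
    TBd (mop n W q) (2 * n * B) := by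
  intro φ hφ
  have key : ∀ a, ‖Finsupp.linearCombination ℂ φ (tsh a q)‖ ≤ B := by
    intro a
    simp only [tsh, Finsupp.lmapDomain_apply, Finsupp.linearCombination_mapDomain]
    exact h _ fun k => hφ _
  simp only [mop, map_sum, map_smul, map_add]
  refine (norm_sum_le _ _).trans ?_
  calc _ ≤ ∑ r ∈ Finset.range n, 2 * B := by
        refine Finset.sum_le_sum fun r hr => ?_
        rw [norm_smul, norm_neg, Complex.norm_real, Real.norm_of_nonneg
          (fejC_nonneg n _ (by have := Finset.mem_range.1 hr; omega))]
        have h1 := fejC_le_one n (r + 1)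
        have h0 := fejC_nonneg n (r + 1) (by have := Finset.mem_range.1 hr; omega)
        have h2 := (norm_add_le (Finsupp.linearCombination ℂ φ (tsh (((r : ℤ) + 1) * W) q))
          (Finsupp.linearCombination ℂ φ (tsh (-(((r : ℤ) + 1) * W)) q))).trans
          (add_le_add (key _) (key _))
        nlinarith [norm_nonneg (Finsupp.linearCombination ℂ φ (tsh (((r : ℤ) + 1) * W) q) +
          Finsupp.linearCombination ℂ φ (tsh (-(((r : ℤ) + 1) * W)) q))]
    _ = _ := by simp; ring

lemma partial_group (n V : ℕ) (b : ℝ) (hb : 0 ≤ b) (s u : ℕ → ℂ) (h1 : ∀ r < V, s r = u r)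
    (h2 : ‖s V‖ ≤ b) (h3 : ∀ r, V < r → s r = 0) :
    ‖∑ r ∈ Finset.range n, s r - ∑ r ∈ Finset.range (min n V), u r‖ ≤ b := by
  rcases le_or_gt n V with h | h
  · rw [min_eq_left h, Finset.sum_congr rfl (fun r hr => h1 r (by
      have := Finset.mem_range.1 hr; omega)), sub_self, norm_zero]; exact hb
  · rw [min_eq_right h.le]
    have : ∑ r ∈ Finset.range n, s r = ∑ r ∈ Finset.range (V + 1), s r := by
      symm
      apply Finset.sum_subset
      · intro r hr; simp only [Finset.mem_range] at *; omega
      · intro r _ hr; simp only [Finset.mem_range] at *; exact h3 r (by omega)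
    rw [this, Finset.sum_range_succ, Finset.sum_congr rfl (fun r hr => h1 r (Finset.mem_range.1 hr)),
      add_sub_cancel_left]
    exact h2

lemma tps_mop_norm (N n : ℕ) (W : ℕ) (q : ℤ →₀ ℂ) (B : ℝ) (hB : TBd q B)
    (hq : ∀ k ∈ q.support, 2 * |k| < (W : ℤ)) (t : AddCircle (2 * π)) (ρ : ℝ) (hρ : 0 < ρ)
    (hw : ρ ≤ ‖(fourier (W : ℤ) t : ℂ) - 1‖) :
    ‖tps N t (mop n W q)‖ ≤ (1 + 2 / ρ) * ‖tev t q‖ + 2 * B := by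
  have hB0 : 0 ≤ B := by
    have := hB 0 (by simp)
    exact (norm_nonneg _).trans this
  have hRHS : 0 ≤ (1 + 2 / ρ) * ‖tev t q‖ + 2 * B := by positivity
  set w : ℂ := fourier (W : ℤ) t with hwdef
  rcases lt_or_ge (2 * N) W with hNW | hNW
  · rw [tps_eq_zero, norm_zero]; exact hRHS
    intro k hk
    obtain ⟨b, hb, r, hr0, -, e⟩ := mop_support _ _ _ _ hk
    have := hq b hb
    have h1 : (1 : ℤ) ≤ |r| := Int.one_le_abs hr0
    have h2 : |r * W| - |b| ≤ |k| := by
      rw [e]; have := abs_sub_abs_le_abs_sub (r * (W : ℤ)) (-b); rw [abs_neg] at this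
      rw [sub_neg_eq_add, add_comm (r * (W : ℤ))] at this; exact this
    rw [abs_mul, Nat.abs_cast] at h2
    have : (W : ℤ) ≤ |r| * W := by nlinarith
    omega
  · rcases Nat.eq_zero_or_pos W with hW0 | hWpos
    · subst hW0
      have : q = 0 := by
        rw [← Finsupp.support_eq_empty, Finset.eq_empty_iff_forall_notMem]
        intro k hk; have := hq k hk; have := abs_nonneg k; push_cast at *; omega
      subst this
      simp only [mop, map_zero, add_zero, smul_zero, Finset.sum_const_zero, norm_zero]; positivity
    obtain ⟨V, hV1, hV2⟩ : ∃ V : ℕ, (2 * V + 1) * W ≤ 2 * N ∧ 2 * N < (2 * V + 3) * W := by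
      refine ⟨(2 * N - W) / (2 * W), ?_, ?_⟩
      · have := Nat.div_mul_le_self (2 * N - W) (2 * W)
        have e : (2 * ((2 * N - W) / (2 * W)) + 1) * W = (2 * N - W) / (2 * W) * (2 * W) + W := by ring
        omega
      · have := Nat.lt_div_mul_add (a := 2 * N - W) (b := 2 * W) (by omega)
        have e : (2 * ((2 * N - W) / (2 * W)) + 3) * W
          = (2 * N - W) / (2 * W) * (2 * W) + 2 * W + W := by ring
        omega
    zify at hV1 hV2
    have hWpos' : (0 : ℤ) < W := by exact_mod_cast hWpos
    have hsmall : ∀ r : ℕ, r < V → ∀ a : ℤ, |a| = ((r : ℤ) + 1) * W →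
        tps N t (tsh a q) = fourier a t * tev t q := by
      intro r hr a ha
      rw [← tev_tsh]
      apply tps_eq_tev
      intro k hk
      obtain ⟨b, hb, e⟩ := tsh_support _ _ _ hk
      have h1 := hq b hb
      have h2 : |k| ≤ |b| + |a| := by rw [e]; exact abs_add_le _ _
      rw [ha] at h2
      have h3 : ((r : ℤ) + 1) * W ≤ V * W := by
        apply mul_le_mul_of_nonneg_right _ hWpos'.le; omega
      nlinarith
    have hlarge : ∀ r : ℕ, V < r → ∀ a : ℤ, |a| = ((r : ℤ) + 1) * W →
        tps N t (tsh a q) = 0 := by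
      intro r hr a ha
      apply tps_eq_zero
      intro k hk
      obtain ⟨b, hb, e⟩ := tsh_support _ _ _ hk
      have h1 := hq b hb
      have h2 : |a| - |b| ≤ |k| := by
        rw [e]; have := abs_sub_abs_le_abs_sub a (-b); rw [abs_neg] at this
        rw [sub_neg_eq_add, add_comm a] at this; exact this
      rw [ha] at h2
      have h3 : ((V : ℤ) + 2) * W ≤ ((r : ℤ) + 1) * W := by
        apply mul_le_mul_of_nonneg_right _ hWpos'.le; omega
      nlinarith
    have habs : ∀ r : ℕ, |((r : ℤ) + 1) * W| = ((r : ℤ) + 1) * W := fun r =>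
      abs_of_nonneg (by positivity)
    have habs' : ∀ r : ℕ, |-(((r : ℤ) + 1) * W)| = ((r : ℤ) + 1) * W := fun r => by
      rw [abs_neg, habs]
    have key := partial_group n V (2 * B) (by positivity)
      (fun r => if r ≤ n then (-(fejC n (r + 1) : ℂ)) • (tps N t (tsh (((r : ℤ) + 1) * W) q) +
        tps N t (tsh (-(((r : ℤ) + 1) * W)) q)) else 0)
      (fun r => if r ≤ n then (-(fejC n (r + 1) : ℂ)) * (w ^ (r + 1) + w⁻¹ ^ (r + 1)) * tev t q
        else 0)
      (by
        intro r hr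
        split_ifs
        · rw [hsmall r hr _ (habs r), hsmall r hr _ (habs' r), fourier_pow, fourier_pow_neg,
            smul_eq_mul]; ring
        · rfl)
      (by
        split_ifs with hVn
        · have h0 := fejC_nonneg n (V + 1) (by omega)
          have h1 := fejC_le_one n (V + 1)
          rw [norm_smul, norm_neg, Complex.norm_real, Real.norm_of_nonneg h0]
          have h2 := (norm_add_le (tps N t (tsh (((V : ℤ) + 1) * W) q))
            (tps N t (tsh (-(((V : ℤ) + 1) * W)) q))).trans
            (add_le_add (TBd_tps hB _ _ _) (TBd_tps hB _ _ _))
          nlinarith [norm_nonneg (tps N t (tsh (((V : ℤ) + 1) * W) q) +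
            tps N t (tsh (-(((V : ℤ) + 1) * W)) q))]
        · rw [norm_zero]; positivity)
      (by
        intro r hr
        rw [hlarge r hr _ (habs r), hlarge r hr _ (habs' r)]; simp)
    have e1 : tps N t (mop n W q) = ∑ r ∈ Finset.range n, (if r ≤ n then (-(fejC n (r + 1) : ℂ)) •
        (tps N t (tsh (((r : ℤ) + 1) * W) q) +
        tps N t (tsh (-(((r : ℤ) + 1) * W)) q)) else 0) := by
      simp only [mop, map_sum, map_smul, map_add]
      exact Finset.sum_congr rfl fun r hr => by
        rw [if_pos (by have := Finset.mem_range.1 hr; omega)]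
    have e2 : ∑ r ∈ Finset.range (min n V), (if r ≤ n then (-(fejC n (r + 1) : ℂ)) *
        (w ^ (r + 1) + w⁻¹ ^ (r + 1)) * tev t q else 0) =
        (1 - fejK n w (min n V)) * tev t q := by
      rw [fejK, sub_add_cancel_left, neg_mul, Finset.sum_mul, ← Finset.sum_neg_distrib]
      refine Finset.sum_congr rfl fun r hr => ?_
      rw [if_pos (by have := Finset.mem_range.1 hr; omega)]; ring
    rw [← e1, e2] at key
    have hK := fejK_trunc_norm n w (fourier_norm_one _ _) (min n V) (by omega)
    have hK2 : ‖fejK n w (min n V)‖ ≤ 2 / ρ := by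
      rw [le_div_iff₀ hρ]
      nlinarith [norm_nonneg (fejK n w (min n V))]
    have h4 : ‖(1 - fejK n w (min n V)) * tev t q‖ ≤ (1 + 2 / ρ) * ‖tev t q‖ := by
      rw [norm_mul]
      gcongr
      refine (norm_sub_le _ _).trans ?_
      rw [norm_one]; gcongr
    calc ‖tps N t (mop n W q)‖ ≤ ‖(1 - fejK n w (min n V)) * tev t q‖ +
          ‖tps N t (mop n W q) - (1 - fejK n w (min n V)) * tev t q‖ := norm_le_insert' _ _
      _ ≤ _ := by gcongr

/-! ### Measure estimates -/

lemma norm_le_fourier_one (t : AddCircle (2 * π)) :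
    ‖t‖ ≤ π / 2 * ‖(fourier 1 t : ℂ) - 1‖ := by
  obtain ⟨x, rfl⟩ := QuotientAddGroup.mk_surjective t
  obtain ⟨y, hy, hyx⟩ : ∃ y : ℝ, |y| ≤ π ∧ ((y : ℝ) : AddCircle (2 * π)) = (x : AddCircle (2 * π)) := by
    refine ⟨x - round ((2 * π)⁻¹ * x) * (2 * π), ?_, ?_⟩
    · rw [← AddCircle.norm_eq]
      have := AddCircle.norm_le_half_period (2 * π) (x := (x : AddCircle (2 * π))) (by positivity)
      rw [abs_of_pos (by positivity)] at this
      linarith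
    · rw [AddCircle.coe_sub, sub_eq_self, ← zsmul_eq_mul, AddCircle.coe_zsmul, AddCircle.coe_period,
        smul_zero]
  change ‖(x : AddCircle (2 * π))‖ ≤ π / 2 * ‖(fourier 1 (x : AddCircle (2 * π)) : ℂ) - 1‖
  rw [← hyx, (AddCircle.norm_coe_eq_abs_iff (2 * π) (by positivity)).2 (by
    rw [abs_of_pos (a := 2 * π) (by positivity)]; linarith)]
  have e : (fourier 1 (y : AddCircle (2 * π)) : ℂ) = Complex.exp (Complex.I * y) := by
    rw [fourier_coe_apply]
    congr 1
    have : (π : ℂ) ≠ 0 := by exact_mod_cast pi_ne_zero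
    push_cast
    field_simp
  rw [e, Complex.norm_exp_I_mul_ofReal_sub_one, norm_mul, Real.norm_eq_abs, Real.norm_eq_abs,
    abs_of_pos (a := (2 : ℝ)) (by norm_num)]
  have h := Real.mul_abs_le_abs_sin (x := y / 2) (by rw [abs_div, abs_of_pos (a := (2 : ℝ)) (by norm_num)]; linarith)
  have h2 : |y / 2| = |y| / 2 := by rw [abs_div, abs_of_pos (a := (2 : ℝ)) (by norm_num)]
  rw [h2] at h
  have h3 : π * (2 / π * (|y| / 2)) = |y| := by field_simp
  nlinarith [pi_pos]

lemma volume_near_one (W : ℕ) (hW : 1 ≤ W) (ρ : ℝ) (hρ : 0 ≤ ρ) :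
    volume {t : AddCircle (2 * π) | ‖(fourier (W : ℤ) t : ℂ) - 1‖ < ρ} ≤ ENNReal.ofReal (4 * ρ) := by
  have h1 : volume {t : AddCircle (2 * π) | ‖(fourier 1 t : ℂ) - 1‖ < ρ} ≤ ENNReal.ofReal (4 * ρ) := by
    calc _ ≤ volume (Metric.closedBall (0 : AddCircle (2 * π)) (π / 2 * ρ)) := by
          apply measure_mono
          intro t ht
          rw [mem_closedBall_zero_iff]
          refine (norm_le_fourier_one t).trans ?_
          have : ‖(fourier 1 t : ℂ) - 1‖ < ρ := ht
          gcongr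
      _ ≤ _ := by
          rw [AddCircle.volume_closedBall]
          apply ENNReal.ofReal_le_ofReal
          refine (min_le_right _ _).trans ?_
          nlinarith [pi_le_four]
  rcases Nat.lt_or_ge 1 W with h | h
  · have hm := (AddCircle.ergodic_nsmul (T := 2 * π) h).toMeasurePreserving
    have ho : MeasurableSet {t : AddCircle (2 * π) | ‖(fourier 1 t : ℂ) - 1‖ < ρ} := by
      apply IsOpen.measurableSet
      exact isOpen_lt (by fun_prop) continuous_const
    rw [← hm.measure_preimage ho.nullMeasurableSet] at h1
    convert h1 using 3
    simp [fourier_apply]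
  · have : W = 1 := by omega
    subst this
    exact h1

lemma tev_continuous (q : ℤ →₀ ℂ) : Continuous (fun t => tev t q) := by
  simp only [tev, Finsupp.linearCombination_apply, Finsupp.sum]
  fun_prop

lemma trig_dense (r : AddCircle (2 * π) → ℂ) (hr : Measurable r) (e : ℝ) (he : 0 < e) :
    ∃ q : ℤ →₀ ℂ, volume {t | e ≤ ‖r t - tev t q‖} ≤ ENNReal.ofReal e := by
  -- truncation
  have h1 : Tendsto (fun K : ℕ => volume {t | (K : ℝ) ≤ ‖r t‖}) atTop (𝓝 0) := by
    have := tendsto_measure_iInter_atTop (μ := (volume : Measure (AddCircle (2 * π))))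
      (s := fun K : ℕ => {t | (K : ℝ) ≤ ‖r t‖})
      (fun K => (measurableSet_le measurable_const hr.norm).nullMeasurableSet)
      (by
        intro a b hab t ht
        simp only [Set.mem_setOf_eq] at *
        have : (a : ℝ) ≤ b := by exact_mod_cast hab
        linarith)
      ⟨0, measure_ne_top _ _⟩
    have he : (⋂ K : ℕ, {t | (K : ℝ) ≤ ‖r t‖}) = ∅ := by
      ext t
      simp only [Set.mem_iInter, Set.mem_setOf_eq, Set.mem_empty_iff_false, iff_false, not_forall,
        not_le]
      exact exists_nat_gt _
    rw [he, measure_empty] at this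
    exact this
  have hpos : (0 : ENNReal) < ENNReal.ofReal (e / 2) := by simpa using he
  obtain ⟨K, hK⟩ := (h1.eventually (gt_mem_nhds hpos)).exists
  set s : AddCircle (2 * π) → ℂ := fun t => if (K : ℝ) ≤ ‖r t‖ then 0 else r t with hs
  have hsm : Measurable s :=
    Measurable.ite (measurableSet_le measurable_const hr.norm) measurable_const hr
  have hsi : Integrable s volume := by
    refine Integrable.of_bound hsm.aestronglyMeasurable (K : ℝ) (Eventually.of_forall fun t => ?_)
    simp only [hs]
    split_ifs with h
    · simp
    · exact (not_le.1 h).le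
  obtain ⟨g, hg, -⟩ := hsi.exists_boundedContinuous_lintegral_sub_le
    (ε := ENNReal.ofReal (e / 2) * ENNReal.ofReal (e / 2)) (by
      simp only [ne_eq, mul_eq_zero, or_self]; exact hpos.ne')
  have h2 : volume {t | ENNReal.ofReal (e / 2) ≤ ‖s t - g t‖ₑ} ≤ ENNReal.ofReal (e / 2) := by
    refine (meas_ge_le_lintegral_div ?_ hpos.ne' ENNReal.ofReal_ne_top).trans ?_
    · exact ((hsm.sub g.continuous.measurable).enorm).aemeasurable
    · exact ENNReal.div_le_of_le_mul hg
  obtain ⟨q, hq⟩ : ∃ q : ℤ →₀ ℂ, ∀ t, ‖g t - tev t q‖ < e / 2 := by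
    have hmem : (g : C(AddCircle (2 * π), ℂ)) ∈
        (Submodule.span ℂ (Set.range (@fourier (2 * π)))).topologicalClosure := by
      rw [span_fourier_closure_eq_top]; trivial
    have hmem2 : (g : C(AddCircle (2 * π), ℂ)) ∈
        closure ((Submodule.span ℂ (Set.range (@fourier (2 * π)))) : Set C(AddCircle (2 * π), ℂ)) :=
      hmem
    obtain ⟨p, hp, hd⟩ := Metric.mem_closure_iff.1 hmem2 (e / 2) (by positivity)
    obtain ⟨q, hq⟩ := Finsupp.mem_span_range_iff_exists_finsupp.1 hp
    refine ⟨q, fun t => ?_⟩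
    have e1 : tev t q = p t := by
      rw [← hq]
      simp [tev, Finsupp.linearCombination_apply, Finsupp.sum]
    rw [e1, ← dist_eq_norm]
    exact (ContinuousMap.dist_apply_le_dist t).trans_lt hd
  refine ⟨q, ?_⟩
  calc volume {t | e ≤ ‖r t - tev t q‖}
      ≤ volume ({t | (K : ℝ) ≤ ‖r t‖} ∪ {t | ENNReal.ofReal (e / 2) ≤ ‖s t - g t‖ₑ}) := by
        apply measure_mono
        intro t ht
        simp only [Set.mem_setOf_eq, Set.mem_union] at *
        by_contra hcon
        push Not at hcon
        obtain ⟨c1, c2⟩ := hcon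
        have hst : s t = r t := by simp only [hs]; rw [if_neg (not_le.2 c1)]
        rw [hst, ← ofReal_norm, ENNReal.ofReal_lt_ofReal_iff (by positivity)] at c2
        have c3 := hq t
        have := norm_sub_le_norm_sub_add_norm_sub (r t) (g t) (tev t q)
        linarith
    _ ≤ ENNReal.ofReal (e / 2) + ENNReal.ofReal (e / 2) :=
        (measure_union_le _ _).trans (add_le_add hK.le h2)
    _ = ENNReal.ofReal e := by
        rw [← ENNReal.ofReal_add (by positivity) (by positivity)]; congr 1; ring

/-! ### The basic block -/

/-- The localized factor. -/
noncomputable def psiP (D n' M m : ℕ) (g : ℤ →₀ ℂ) : ℤ →₀ ℂ :=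
  ∑ e ∈ Finset.range (2 * D + 1),
    mop n' ((m * M ^ e : ℕ) : ℤ) (Finsupp.single ((e : ℤ) - D) (g ((e : ℤ) - D)))

noncomputable def blkP (D n' n N M m : ℕ) (g : ℤ →₀ ℂ) : ℤ →₀ ℂ :=
  ∑ i ∈ Finset.range N,
    (1 / (N : ℂ)) • mop n ((m * M ^ (2 * D + 1 + i) : ℕ) : ℤ) (psiP D n' M m g)

def blkS (D n' n N M m : ℕ) : Set ℤ :=
  {ω | ∃ i < N, ∃ k : ℤ, k ≠ 0 ∧ |k| ≤ n ∧ ∃ e < 2 * D + 1, ∃ k' : ℤ, k' ≠ 0 ∧ |k'| ≤ n' ∧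
    ω = ((e : ℤ) - D + k' * ((m * M ^ e : ℕ) : ℤ)) + k * ((m * M ^ (2 * D + 1 + i) : ℕ) : ℤ)}

lemma psiP_support (D n' M m : ℕ) (g : ℤ →₀ ℂ) (k : ℤ) (hk : k ∈ (psiP D n' M m g).support) :
    ∃ e < 2 * D + 1, ∃ k' : ℤ, k' ≠ 0 ∧ |k'| ≤ n' ∧
      k = (e : ℤ) - D + k' * ((m * M ^ e : ℕ) : ℤ) := by
  have h1 := Finsupp.support_finsetSum hk
  simp only [Finset.mem_biUnion, Finset.mem_range] at h1
  obtain ⟨e, he, h2⟩ := h1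
  obtain ⟨b, hb, r, hr0, hr, h3⟩ := mop_support _ _ _ _ h2
  have h4 := Finsupp.support_single_subset hb
  rw [Finset.mem_singleton] at h4
  exact ⟨e, he, r, hr0, hr, by rw [h3, h4]⟩

lemma blkP_support (D n' n N M m : ℕ) (g : ℤ →₀ ℂ) :
    ((blkP D n' n N M m g).support : Set ℤ) ⊆ blkS D n' n N M m := by
  intro k hk
  have h1 := Finsupp.support_finsetSum (Finset.mem_coe.1 hk)
  simp only [Finset.mem_biUnion, Finset.mem_range] at h1
  obtain ⟨i, hi, h2⟩ := h1
  obtain ⟨b, hb, r, hr0, hr, h3⟩ := mop_support _ _ _ _ (Finsupp.support_smul h2)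
  obtain ⟨e, he, k', hk', hk'n, h4⟩ := psiP_support _ _ _ _ _ _ hb
  exact ⟨i, hi, r, hr0, hr, e, he, k', hk', hk'n, by rw [h3, h4]⟩

lemma low_freq_bound (D n' M m e : ℕ) (hM : 4 * (n' + 1) ≤ M) (hm : 8 * (D + 1) ≤ m)
    (he : e < 2 * D + 1) (k' : ℤ) (hk' : |k'| ≤ n') :
    2 * |(e : ℤ) - D + k' * ((m * M ^ e : ℕ) : ℤ)| < ((m * M ^ (2 * D + 1) : ℕ) : ℤ) := by
  have h1 : |(e : ℤ) - D| ≤ D := by rw [abs_le]; constructor <;> omega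
  have hM1 : 1 ≤ M := by omega
  have h2 : |k' * ((m * M ^ e : ℕ) : ℤ)| ≤ n' * ((m * M ^ (2 * D) : ℕ) : ℤ) := by
    rw [abs_mul, Nat.abs_cast]
    have : m * M ^ e ≤ m * M ^ (2 * D) :=
      Nat.mul_le_mul_left _ (Nat.pow_le_pow_right hM1 (by omega))
    gcongr
  have h3 := abs_add_le ((e : ℤ) - D) (k' * ((m * M ^ e : ℕ) : ℤ))
  have h4 : 4 * (n' * (m * M ^ (2 * D))) + 4 * (m * M ^ (2 * D)) ≤ m * M ^ (2 * D + 1) := by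
    calc _ = (4 * (n' + 1)) * (m * M ^ (2 * D)) := by ring
      _ ≤ M * (m * M ^ (2 * D)) := Nat.mul_le_mul_right _ hM
      _ = _ := by ring
  have h5 : m ≤ m * M ^ (2 * D) := Nat.le_mul_of_pos_right _ (Nat.pow_pos (by omega))
  zify at h4 h5 hm
  push_cast at *
  nlinarith

lemma blkS_sep (D n' n N M m : ℕ) (hM : 4 * (n + n' + 1) ≤ M) (hm : 8 * (D + 1) ≤ m)
    (a b : ℤ) (ha : a ∈ blkS D n' n N M m) (hb : b ∈ blkS D n' n N M m) (hab : a ≠ b) :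
    (m : ℤ) ≤ 2 * |a - b| := by
  obtain ⟨i, hi, k, hk0, hkn, e, he, k', hk'0, hk'n, rfl⟩ := ha
  obtain ⟨j, hj, l, hl0, hln, f, hf, l', hl'0, hl'n, rfl⟩ := hb
  set z : ℤ := (k' * (M : ℤ) ^ e + k * (M : ℤ) ^ (2 * D + 1 + i)) -
    (l' * (M : ℤ) ^ f + l * (M : ℤ) ^ (2 * D + 1 + j)) with hz
  have hdiff : ((e : ℤ) - D + k' * ((m * M ^ e : ℕ) : ℤ)) + k * ((m * M ^ (2 * D + 1 + i) : ℕ) : ℤ) -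
      (((f : ℤ) - D + l' * ((m * M ^ f : ℕ) : ℤ)) + l * ((m * M ^ (2 * D + 1 + j) : ℕ) : ℤ)) =
      ((e : ℤ) - f) + m * z := by
    rw [hz]; push_cast; ring
  have hM0 : (M : ℤ) ≠ 0 := by omega

  have aux : ∀ (e f i j : ℕ) (k k' l l' : ℤ), e < f → e < 2 * D + 1 → k' ≠ 0 → |k'| ≤ n' →
      (k' * (M : ℤ) ^ e + k * (M : ℤ) ^ (2 * D + 1 + i)) =
      (l' * (M : ℤ) ^ f + l * (M : ℤ) ^ (2 * D + 1 + j)) → False := by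
    intro e f i j k k' l l' hef he hk0 hkn h
    have d1 : (M : ℤ) ^ (e + 1) ∣ k' * (M : ℤ) ^ e := by
      have : k' * (M : ℤ) ^ e = l' * (M : ℤ) ^ f + l * (M : ℤ) ^ (2 * D + 1 + j)
        - k * (M : ℤ) ^ (2 * D + 1 + i) := by linarith
      rw [this]
      exact dvd_sub (dvd_add (Dvd.dvd.mul_left (pow_dvd_pow _ hef) _)
        (Dvd.dvd.mul_left (pow_dvd_pow _ (by omega)) _))
        (Dvd.dvd.mul_left (pow_dvd_pow _ (by omega)) _)
    rw [pow_succ', mul_comm k', mul_comm (M : ℤ)] at d1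
    have d2 : (M : ℤ) ∣ k' := (mul_dvd_mul_iff_left (pow_ne_zero e hM0)).1 d1
    have := Int.le_of_dvd (abs_pos.2 hk0) ((dvd_abs _ _).2 d2)
    omega
  have hz0 : z ≠ 0 := by
    intro h0
    have heq := sub_eq_zero.1 (hz ▸ h0)
    have hef : e = f := by
      rcases lt_trichotomy e f with h | h | h
      · exact (aux e f i j k k' l l' h he hk'0 hk'n heq).elim
      · exact h
      · exact (aux f e j i l l' k k' h hf hl'0 hl'n heq.symm).elim
    apply hab
    rw [← sub_eq_zero, hdiff, h0, hef]; ring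
  rw [hdiff]
  have h1 : (1 : ℤ) ≤ |z| := Int.one_le_abs hz0
  have h2 : |(m : ℤ) * z| - |(e : ℤ) - f| ≤ |((e : ℤ) - f) + m * z| := by
    have := abs_sub_abs_le_abs_sub ((m : ℤ) * z) (-((e : ℤ) - f))
    rw [abs_neg, sub_neg_eq_add, add_comm ((m : ℤ) * z)] at this; exact this
  rw [abs_mul, Nat.abs_cast] at h2
  have h3 : |(e : ℤ) - f| ≤ 2 * D := by rw [abs_le]; constructor <;> omega
  have h4 : (m : ℤ) ≤ m * |z| := by nlinarith
  omega

lemma blkS_lower (D n' n N M m : ℕ) (hM : 4 * (n + n' + 1) ≤ M) (hm : 8 * (D + 1) ≤ m)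
    (a : ℤ) (ha : a ∈ blkS D n' n N M m) : (m : ℤ) < 2 * |a| := by
  obtain ⟨i, hi, k, hk0, hkn, e, he, k', hk'0, hk'n, rfl⟩ := ha
  have h1 := low_freq_bound D n' M m e (by omega) hm he k' hk'n
  set x := (e : ℤ) - D + k' * ((m * M ^ e : ℕ) : ℤ)
  have hk1 : (1 : ℤ) ≤ |k| := Int.one_le_abs hk0
  have h2 : |k * ((m * M ^ (2 * D + 1 + i) : ℕ) : ℤ)| - |x| ≤
      |x + k * ((m * M ^ (2 * D + 1 + i) : ℕ) : ℤ)| := by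
    have := abs_sub_abs_le_abs_sub (k * ((m * M ^ (2 * D + 1 + i) : ℕ) : ℤ)) (-x)
    rw [abs_neg, sub_neg_eq_add, add_comm _ x] at this; exact this
  rw [abs_mul, Nat.abs_cast] at h2
  have h3 : m * M ^ (2 * D + 1) ≤ m * M ^ (2 * D + 1 + i) :=
    Nat.mul_le_mul_left _ (Nat.pow_le_pow_right (by omega) (by omega))
  have h4 : m ≤ m * M ^ (2 * D + 1) := Nat.le_mul_of_pos_right _ (Nat.pow_pos (by omega))
  have h5 : ((m * M ^ (2 * D + 1 + i) : ℕ) : ℤ) ≤ |k| * ((m * M ^ (2 * D + 1 + i) : ℕ) : ℤ) := by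
    nlinarith
  zify at h3 h4
  push_cast at *
  linarith

lemma blkS_upper (D n' n N M m : ℕ) (hM : 4 * (n + n' + 1) ≤ M) (hm : 8 * (D + 1) ≤ m)
    (a : ℤ) (ha : a ∈ blkS D n' n N M m) :
    |a| ≤ ((m * ((n + 1) * M ^ (2 * D + 1 + N)) : ℕ) : ℤ) := by
  obtain ⟨i, hi, k, hk0, hkn, e, he, k', hk'0, hk'n, rfl⟩ := ha
  have h1 := low_freq_bound D n' M m e (by omega) hm he k' hk'n
  set x := (e : ℤ) - D + k' * ((m * M ^ e : ℕ) : ℤ)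
  have h2 := abs_add_le x (k * ((m * M ^ (2 * D + 1 + i) : ℕ) : ℤ))
  rw [abs_mul, Nat.abs_cast] at h2
  have h3 : m * M ^ (2 * D + 1) ≤ m * M ^ (2 * D + 1 + N) :=
    Nat.mul_le_mul_left _ (Nat.pow_le_pow_right (by omega) (by omega))
  have h4 : m * M ^ (2 * D + 1 + i) ≤ m * M ^ (2 * D + 1 + N) :=
    Nat.mul_le_mul_left _ (Nat.pow_le_pow_right (by omega) (by omega))
  have h5 : |k| * ((m * M ^ (2 * D + 1 + i) : ℕ) : ℤ) ≤ n * ((m * M ^ (2 * D + 1 + N) : ℕ) : ℤ) := by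
    have : ((m * M ^ (2 * D + 1 + i) : ℕ) : ℤ) ≤ ((m * M ^ (2 * D + 1 + N) : ℕ) : ℤ) := by
      exact_mod_cast h4
    gcongr
  have h6 : ((m * ((n + 1) * M ^ (2 * D + 1 + N)) : ℕ) : ℤ) =
      n * ((m * M ^ (2 * D + 1 + N) : ℕ) : ℤ) + ((m * M ^ (2 * D + 1 + N) : ℕ) : ℤ) := by
    push_cast; ring
  have h7 : ((m * M ^ (2 * D + 1) : ℕ) : ℤ) ≤ ((m * M ^ (2 * D + 1 + N) : ℕ) : ℤ) := by
    exact_mod_cast h3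
  have h8 := abs_nonneg x
  rw [h6]
  linarith

lemma sum_single_eq (D : ℕ) (g : ℤ →₀ ℂ) (hg : ∀ k ∈ g.support, |k| ≤ (D : ℤ)) :
    ∑ e ∈ Finset.range (2 * D + 1), Finsupp.single ((e : ℤ) - D) (g ((e : ℤ) - D)) = g := by
  ext k
  rw [Finsupp.finsetSum_apply]
  by_cases hk : |k| ≤ (D : ℤ)
  · have := abs_le.1 hk
    rw [Finset.sum_eq_single (k + D).toNat]
    · have : (((k + D).toNat : ℕ) : ℤ) - D = k := by omega
      rw [this, Finsupp.single_eq_same]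
    · intro e _ hne
      rw [Finsupp.single_apply, if_neg]
      omega
    · intro h
      exact (h (Finset.mem_range.2 (by omega))).elim
  · have h0 : g k = 0 := by
      by_contra h
      exact hk (hg k (Finsupp.mem_support_iff.2 h))
    rw [h0]
    refine Finset.sum_eq_zero fun e he => ?_
    rw [Finsupp.single_apply, if_neg]
    have := Finset.mem_range.1 he
    intro h
    apply hk
    rw [abs_le]; constructor <;> omega

lemma fejK_full_norm' (n : ℕ) (w : ℂ) (hw : ‖w‖ = 1) (ρ : ℝ) (hρ : 0 < ρ) (h : ρ ≤ ‖w - 1‖) :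
    ‖fejK n w n‖ ≤ 4 / ((n + 1) * ρ ^ 2) := by
  have h1 := fejK_full_norm n w hw
  rw [← div_div, le_div_iff₀ (by positivity)]
  calc _ ≤ ‖fejK n w n‖ * ‖w - 1‖ ^ 2 := by gcongr
    _ ≤ _ := by linarith

lemma psiP_close (D n' M m : ℕ) (g : ℤ →₀ ℂ) (hg : ∀ k ∈ g.support, |k| ≤ (D : ℤ)) (A : ℝ)
    (hA : ∀ k, ‖g k‖ ≤ A) (ρ : ℝ) (hρ : 0 < ρ) (t : AddCircle (2 * π))
    (ht : ∀ e < 2 * D + 1, ρ ≤ ‖(fourier ((m * M ^ e : ℕ) : ℤ) t : ℂ) - 1‖) :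
    ‖tev t (psiP D n' M m g) - tev t g‖ ≤ (2 * D + 1) * (A * (4 / ((n' + 1) * ρ ^ 2))) := by
  have e1 : tev t g = ∑ e ∈ Finset.range (2 * D + 1),
      tev t (Finsupp.single ((e : ℤ) - D) (g ((e : ℤ) - D))) := by
    rw [← map_sum, sum_single_eq D g hg]
  have hs : ∀ k c, ‖tev t (Finsupp.single k c)‖ = ‖c‖ := by
    intro k c
    rw [tev, Finsupp.linearCombination_single, norm_smul, fourier_norm_one, mul_one]
  rw [e1, psiP, map_sum, ← Finset.sum_sub_distrib]
  refine (norm_sum_le _ _).trans ?_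
  calc _ ≤ ∑ e ∈ Finset.range (2 * D + 1), A * (4 / ((n' + 1) * ρ ^ 2)) := by
        refine Finset.sum_le_sum fun e he => ?_
        rw [tev_mop, sub_mul, one_mul, sub_sub_cancel_left, norm_neg, norm_mul, hs, mul_comm]
        have := fejK_full_norm' n' _ (fourier_norm_one _ _) ρ hρ (ht e (Finset.mem_range.1 he))
        have hA0 : 0 ≤ A := (norm_nonneg _).trans (hA 0)
        exact mul_le_mul (hA _) this (norm_nonneg _) hA0
    _ = _ := by simp

lemma TBd_psiP (D n' M m : ℕ) (g : ℤ →₀ ℂ) (A : ℝ) (hA : ∀ k, ‖g k‖ ≤ A) :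
    TBd (psiP D n' M m g) ((2 * D + 1) * (2 * n' * A)) := by
  intro φ hφ
  rw [psiP, map_sum]
  refine (norm_sum_le _ _).trans ?_
  calc _ ≤ ∑ e ∈ Finset.range (2 * D + 1), (2 * n' * A) := by
        refine Finset.sum_le_sum fun e he => ?_
        refine TBd_mop (B := A) ?_ n' _ φ hφ
        intro φ' hφ'
        rw [Finsupp.linearCombination_single, norm_smul]
        have h0 : 0 ≤ A := (norm_nonneg _).trans (hA 0)
        calc _ ≤ A * 1 := mul_le_mul (hA _) (hφ' _) (norm_nonneg _) h0
          _ = A := mul_one A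
    _ = _ := by simp

lemma tev_bound (D : ℕ) (g : ℤ →₀ ℂ) (hg : ∀ k ∈ g.support, |k| ≤ (D : ℤ)) (A : ℝ)
    (hA : ∀ k, ‖g k‖ ≤ A) (t : AddCircle (2 * π)) : ‖tev t g‖ ≤ (2 * D + 1) * A := by
  rw [← sum_single_eq D g hg, map_sum]
  refine (norm_sum_le _ _).trans ?_
  calc _ ≤ ∑ e ∈ Finset.range (2 * D + 1), A := by
        refine Finset.sum_le_sum fun e he => ?_
        rw [tev, Finsupp.linearCombination_single, norm_smul, fourier_norm_one, mul_one]
        exact hA _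
    _ = _ := by simp

lemma blkP_close (D n' n N M m : ℕ) (hN : 1 ≤ N) (g : ℤ →₀ ℂ) (ρ : ℝ) (hρ : 0 < ρ)
    (t : AddCircle (2 * π))
    (ht : ∀ i < N, ρ ≤ ‖(fourier ((m * M ^ (2 * D + 1 + i) : ℕ) : ℤ) t : ℂ) - 1‖) :
    ‖tev t (blkP D n' n N M m g) - tev t (psiP D n' M m g)‖ ≤
      4 / ((n + 1) * ρ ^ 2) * ‖tev t (psiP D n' M m g)‖ := by
  have hN0 : (N : ℂ) ≠ 0 := by exact_mod_cast (by omega : N ≠ 0)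
  have hN0' : (N : ℝ) ≠ 0 := by exact_mod_cast (by omega : N ≠ 0)
  set Ψ := psiP D n' M m g
  have e1 : tev t Ψ = ∑ i ∈ Finset.range N, (1 / (N : ℂ)) * tev t Ψ := by
    rw [Finset.sum_const, Finset.card_range, nsmul_eq_mul]; field_simp
  conv_lhs => rw [e1]
  rw [blkP, map_sum, ← Finset.sum_sub_distrib]
  refine (norm_sum_le _ _).trans ?_
  calc _ ≤ ∑ i ∈ Finset.range N, 1 / (N : ℝ) * (4 / ((n + 1) * ρ ^ 2) * ‖tev t Ψ‖) := by
        refine Finset.sum_le_sum fun i hi => ?_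
        rw [map_smul, tev_mop, smul_eq_mul, ← mul_sub, sub_mul, one_mul, sub_sub_cancel_left,
          norm_mul, norm_neg, norm_mul, norm_div, norm_one, Complex.norm_natCast]
        have := fejK_full_norm' n _ (fourier_norm_one _ _) ρ hρ (ht i (Finset.mem_range.1 hi))
        gcongr
    _ = _ := by
        rw [Finset.sum_const, Finset.card_range, nsmul_eq_mul]; field_simp

lemma blkP_partial (D n' n N M m : ℕ) (hN : 1 ≤ N) (hM : 4 * (n + n' + 1) ≤ M)
    (hm : 8 * (D + 1) ≤ m) (g : ℤ →₀ ℂ) (B : ℝ) (hB : TBd (psiP D n' M m g) B)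
    (ρ : ℝ) (hρ : 0 < ρ) (hn : 4 / ((n + 1) * ρ ^ 2) ≤ 1)
    (t : AddCircle (2 * π))
    (ht : ∀ i < N, ρ ≤ ‖(fourier ((m * M ^ (2 * D + 1 + i) : ℕ) : ℤ) t : ℂ) - 1‖) (N' : ℕ) :
    ‖tps N' t (blkP D n' n N M m g)‖ ≤
      (3 + 2 / (ρ * N)) * ‖tev t (psiP D n' M m g)‖ + 2 * B / N := by
  have hB0 : 0 ≤ B := by
    have := hB 0 (by simp)
    exact (norm_nonneg _).trans this
  have hNpos : (0 : ℝ) < N := by exact_mod_cast hN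
  have hN1 : (1 : ℝ) ≤ N := by exact_mod_cast hN
  set Ψ := psiP D n' M m g with hΨ
  set W : ℕ → ℕ := fun i => m * M ^ (2 * D + 1 + i) with hW
  have hΨsup : ∀ i, ∀ k ∈ Ψ.support, 2 * |k| < (W i : ℤ) := by
    intro i k hk
    obtain ⟨e, he, k', hk'0, hk'n, rfl⟩ := psiP_support _ _ _ _ _ _ hk
    refine (low_freq_bound D n' M m e (by omega) hm he k' hk'n).trans_le ?_
    have : m * M ^ (2 * D + 1) ≤ W i :=
      Nat.mul_le_mul_left _ (Nat.pow_le_pow_right (by omega) (by omega))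
    exact_mod_cast this
  set X : ℝ := (1 + 2 / ρ) * ‖tev t Ψ‖ + 2 * B with hX
  have hX0 : 0 ≤ X := by positivity
  set P : ℕ → Prop := fun i => W i ≤ 2 * N' ∧ N' < (n + 1) * W i with hP
  have hterm : ∀ i ∈ Finset.range N, ‖tps N' t (mop n (W i : ℤ) Ψ)‖ ≤
      2 * ‖tev t Ψ‖ + (if P i then X else 0) := by
    intro i hi
    have hi' := Finset.mem_range.1 hi
    have hWpos : (0 : ℤ) < W i := by
      have : 0 < W i := Nat.mul_pos (by omega) (Nat.pow_pos (by omega))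
      exact_mod_cast this
    by_cases hPi : P i
    · rw [if_pos hPi]
      have := tps_mop_norm N' n (W i) Ψ B hB (hΨsup i) t ρ hρ (ht i hi')
      have := norm_nonneg (tev t Ψ)
      linarith
    · rw [if_neg hPi, add_zero]
      rcases lt_or_ge (2 * N') (W i) with h | h
      · rw [tps_eq_zero, norm_zero]; positivity
        intro k hk
        obtain ⟨b, hb, r, hr0, -, e⟩ := mop_support _ _ _ _ hk
        have h0 := hΨsup i b hb
        have h1 : (1 : ℤ) ≤ |r| := Int.one_le_abs hr0
        have h2 : |r * W i| - |b| ≤ |k| := by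
          rw [e]; have := abs_sub_abs_le_abs_sub (r * (W i : ℤ)) (-b); rw [abs_neg] at this
          rw [sub_neg_eq_add, add_comm (r * (W i : ℤ))] at this; exact this
        rw [abs_mul, Nat.abs_cast] at h2
        have : (W i : ℤ) ≤ |r| * W i := by nlinarith
        omega
      · have h' : (n + 1) * W i ≤ N' := by
          by_contra hc
          exact hPi ⟨h, not_le.1 hc⟩
        rw [tps_eq_tev, tev_mop, norm_mul]
        · have h1 := fejK_full_norm' n _ (fourier_norm_one _ _) ρ hρ (ht i hi')
          have h2 := norm_sub_le (1 : ℂ) (fejK n (fourier (W i : ℤ) t) n)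
          rw [norm_one] at h2
          apply mul_le_mul_of_nonneg_right _ (norm_nonneg _)
          linarith
        · intro k hk
          obtain ⟨b, hb, r, hr0, hrn, e⟩ := mop_support _ _ _ _ hk
          have h0 := hΨsup i b hb
          have h2 : |k| ≤ |b| + |r * W i| := by rw [e]; exact abs_add_le _ _
          rw [abs_mul, Nat.abs_cast] at h2
          have h3 : |r| * (W i : ℤ) ≤ n * W i := mul_le_mul_of_nonneg_right hrn hWpos.le
          zify at h'
          have := abs_nonneg b
          nlinarith
  have hsum : ∑ i ∈ Finset.range N, (if P i then X else 0) ≤ X := by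
    classical
    rw [← Finset.sum_filter, Finset.sum_const, nsmul_eq_mul]
    have : ((Finset.range N).filter P).card ≤ 1 := by
      rw [Finset.card_le_one]
      have aux : ∀ i j, P i → P j → i < j → False := by
        intro i j hi hj hij
        have h1 : M * W i ≤ W j := by
          calc M * W i = m * M ^ (2 * D + 1 + i + 1) := by simp only [hW]; ring
            _ ≤ W j := Nat.mul_le_mul_left _ (Nat.pow_le_pow_right (by omega) (by omega))
        have h2 := hi.2
        have h3 := hj.1
        have h4 : 2 * (n + 1) * W i ≤ M * W i := Nat.mul_le_mul_right _ (by omega)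
        nlinarith
      intro i hi j hj
      have hi' := (Finset.mem_filter.1 hi).2
      have hj' := (Finset.mem_filter.1 hj).2
      rcases lt_trichotomy i j with h | h | h
      · exact (aux i j hi' hj' h).elim
      · exact h
      · exact (aux j i hj' hi' h).elim
    have h1 : ((((Finset.range N).filter P).card : ℕ) : ℝ) ≤ 1 := by exact_mod_cast this
    nlinarith
  calc ‖tps N' t (blkP D n' n N M m g)‖ ≤
        ∑ i ∈ Finset.range N, 1 / (N : ℝ) * (2 * ‖tev t Ψ‖ + (if P i then X else 0)) := by
        rw [blkP, map_sum]
        refine (norm_sum_le _ _).trans (Finset.sum_le_sum fun i hi => ?_)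
        rw [map_smul, norm_smul, norm_div, norm_one, Complex.norm_natCast]
        have := hterm i hi
        gcongr
    _ = 1 / (N : ℝ) * (N * (2 * ‖tev t Ψ‖) + ∑ i ∈ Finset.range N, (if P i then X else 0)) := by
        rw [← Finset.mul_sum, Finset.sum_add_distrib, Finset.sum_const, Finset.card_range,
          nsmul_eq_mul]
    _ ≤ 1 / (N : ℝ) * (N * (2 * ‖tev t Ψ‖) + X) := by gcongr
    _ = (2 + 1 / N + 2 / (ρ * N)) * ‖tev t Ψ‖ + 2 * B / N := by
        rw [hX]; field_simp; ring
    _ ≤ _ := by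
        have : 1 / (N : ℝ) ≤ 1 := by rw [div_le_one hNpos]; exact hN1
        gcongr
        linarith

lemma volume_bad (K : ℕ) (W : ℕ → ℕ) (hW : ∀ i, 1 ≤ W i) (ρ : ℝ) (hρ : 0 ≤ ρ) :
    volume {t : AddCircle (2 * π) | ∃ i < K, ‖(fourier (W i : ℤ) t : ℂ) - 1‖ < ρ} ≤
      ENNReal.ofReal (K * (4 * ρ)) := by
  have : {t : AddCircle (2 * π) | ∃ i < K, ‖(fourier (W i : ℤ) t : ℂ) - 1‖ < ρ} =
      ⋃ i ∈ Finset.range K, {t | ‖(fourier (W i : ℤ) t : ℂ) - 1‖ < ρ} := by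
    ext t; simp
  rw [this]
  refine (measure_biUnion_finset_le _ _).trans ?_
  calc _ ≤ ∑ i ∈ Finset.range K, ENNReal.ofReal (4 * ρ) :=
        Finset.sum_le_sum fun i _ => volume_near_one (W i) (hW i) ρ hρ
    _ = _ := by
        rw [Finset.sum_const, Finset.card_range, nsmul_eq_mul, ENNReal.ofReal_mul (p := (K : ℝ)) (by positivity),
          ENNReal.ofReal_natCast]

lemma exists_fejer_param (x y : ℝ) (hx : 0 < x) (hy : 0 < y) :
    ∃ n : ℕ, 4 / (((n : ℝ) + 1) * x ^ 2) ≤ y := by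
  obtain ⟨n, hn⟩ := exists_nat_gt (4 / (x ^ 2 * y))
  refine ⟨n, ?_⟩
  rw [div_lt_iff₀ (by positivity)] at hn
  rw [div_le_iff₀ (by positivity)]
  have : 0 < x ^ 2 * y := by positivity
  nlinarith

/-- The core block lemma. -/
theorem core_block (D : ℕ) (A η : ℝ) (hA : 0 ≤ A) (hη : 0 < η) :
    ∃ δ : ℝ, 0 < δ ∧ ∀ m0 : ℕ, ∃ (S : Set ℤ) (b : ℕ),
      (∀ k ∈ S, (m0 : ℤ) < |k| ∧ |k| ≤ (b : ℤ)) ∧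
      (∀ k ∈ S, ∀ l ∈ S, |k| < |l| → 0 < k * l → (1 + δ) * (|k| : ℤ) ≤ (|l| : ℤ)) ∧
      ∀ g : ℤ →₀ ℂ, (∀ k ∈ g.support, |k| ≤ (D : ℤ)) → (∀ k, ‖g k‖ ≤ A) →
        ∃ p : ℤ →₀ ℂ, (p.support : Set ℤ) ⊆ S ∧
          volume {t : AddCircle (2 * π) | η ≤ ‖tev t p - tev t g‖} ≤ ENNReal.ofReal η ∧
          ∀ θ, η ≤ θ → volume {t : AddCircle (2 * π) | ∃ N', (3 + 16 / θ) * ‖tev t g‖ + η <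
            ‖tps N' t p‖} ≤ ENNReal.ofReal θ := by
  have hL : (0 : ℝ) < 2 * D + 1 := by positivity
  set τ : ℝ := η / (2 * (3 + 16 / η)) with hτ
  have hτ0 : 0 < τ := by positivity
  set ρ' : ℝ := η / (16 * (2 * D + 1)) with hρ'
  have hρ'0 : 0 < ρ' := by positivity
  obtain ⟨n', hn'⟩ := exists_fejer_param ρ' (τ / ((2 * D + 1) * (A + 1))) hρ'0 (by positivity)
  set B : ℝ := (2 * D + 1) * (2 * n' * A) with hB
  have hB0 : 0 ≤ B := by positivity
  obtain ⟨N, hN⟩ := exists_nat_gt (max 1 (4 * B / η))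
  have hN1 : (1 : ℝ) < N := (le_max_left _ _).trans_lt hN
  have hN2 : 4 * B / η < N := (le_max_right _ _).trans_lt hN
  have hNN : 1 ≤ N := by exact_mod_cast hN1.le
  have hNpos : (0 : ℝ) < N := by linarith
  set κ : ℝ := min 1 (η / (4 * ((2 * D + 1) * A + τ + 1))) with hκ
  have hκ0 : 0 < κ := by rw [hκ]; apply lt_min one_pos; positivity
  obtain ⟨n, hn⟩ := exists_fejer_param (η / (8 * N)) κ (by positivity) hκ0
  set M : ℕ := 4 * (n + n' + 1) with hM
  set U : ℕ := (n + 1) * M ^ (2 * D + 1 + N) with hU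
  have hU0 : 0 < U := Nat.mul_pos (by omega) (Nat.pow_pos (by omega))
  have hU0' : (0 : ℝ) < U := by exact_mod_cast hU0
  have hτ1 : (3 + 16 / η) * τ = η / 2 := by rw [hτ]; field_simp
  have hτ2 : τ ≤ η / 6 := by
    have : 0 < 16 / η := by positivity
    nlinarith
  refine ⟨1 / (2 * U), by positivity, fun m0 => ?_⟩
  set m : ℕ := 8 * (D + 1) + 2 * m0 with hm
  have hm8 : 8 * (D + 1) ≤ m := by omega
  refine ⟨blkS D n' n N M m, m * U, ?_, ?_, ?_⟩
  · intro k hk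
    refine ⟨?_, blkS_upper D n' n N M m le_rfl hm8 k hk⟩
    have := blkS_lower D n' n N M m le_rfl hm8 k hk
    omega
  · intro k hk l hl hkl hpos
    have h1 := blkS_sep D n' n N M m le_rfl hm8 l k hl hk (by rintro rfl; omega)
    have h2 := blkS_upper D n' n N M m le_rfl hm8 k hk
    have h3 : |l - k| = |l| - |k| := by
      rcases pos_and_pos_or_neg_and_neg_of_mul_pos hpos with ⟨a, b⟩ | ⟨a, b⟩
      · rw [abs_of_pos a, abs_of_pos b] at *; rw [abs_of_pos]; omega
      · rw [abs_of_neg a, abs_of_neg b] at *; rw [abs_of_neg] <;> omega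
    rw [h3] at h1
    have h1' : (m : ℝ) ≤ 2 * (((|l| : ℤ) : ℝ) - ((|k| : ℤ) : ℝ)) := by exact_mod_cast h1
    have h2' : ((|k| : ℤ) : ℝ) ≤ m * U := by exact_mod_cast h2
    have h4 : 1 / (2 * (U : ℝ)) * ((|k| : ℤ) : ℝ) ≤ m / 2 := by
      rw [div_mul_eq_mul_div, one_mul, div_le_iff₀ (by positivity)]
      linarith
    linarith
  · intro g hg hgA
    have hB' := TBd_psiP D n' M m g A hgA
    have hWpos : ∀ i, 1 ≤ m * M ^ i := fun i => Nat.mul_pos (by omega) (Nat.pow_pos (by omega))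
    set bad0 : Set (AddCircle (2 * π)) :=
      {t | ∃ e < 2 * D + 1, ‖(fourier ((m * M ^ e : ℕ) : ℤ) t : ℂ) - 1‖ < ρ'} with hbad0
    have hv0 : volume bad0 ≤ ENNReal.ofReal (η / 4) := by
      refine (volume_bad (2 * D + 1) (fun e => m * M ^ e) hWpos ρ' hρ'0.le).trans ?_
      apply ENNReal.ofReal_le_ofReal
      rw [hρ']; push_cast
      apply le_of_eq; field_simp; norm_num
    have hclose : ∀ t ∉ bad0, ‖tev t (psiP D n' M m g) - tev t g‖ ≤ τ := by
      intro t ht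
      refine (psiP_close D n' M m g hg A hgA ρ' hρ'0 t ?_).trans ?_
      · intro e he
        by_contra hc
        exact ht ⟨e, he, not_le.1 hc⟩
      · calc (2 * (D : ℝ) + 1) * (A * (4 / ((n' + 1) * ρ' ^ 2)))
            ≤ (2 * (D : ℝ) + 1) * ((A + 1) * (τ / ((2 * D + 1) * (A + 1)))) := by
              gcongr; linarith
          _ = τ := by field_simp
    have hbadθ : ∀ θ, 0 < θ → volume {t : AddCircle (2 * π) | ∃ i < N,
        ‖(fourier ((m * M ^ (2 * D + 1 + i) : ℕ) : ℤ) t : ℂ) - 1‖ < θ / (8 * N)} ≤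
        ENNReal.ofReal (θ / 2) := by
      intro θ hθ
      refine (volume_bad N (fun i => m * M ^ (2 * D + 1 + i)) (fun i => hWpos _) _
        (by positivity)).trans ?_
      apply ENNReal.ofReal_le_ofReal
      apply le_of_eq; field_simp; norm_num
    refine ⟨blkP D n' n N M m g, blkP_support _ _ _ _ _ _ _, ?_, ?_⟩
    · refine (measure_mono (t := bad0 ∪ {t : AddCircle (2 * π) | ∃ i < N,
        ‖(fourier ((m * M ^ (2 * D + 1 + i) : ℕ) : ℤ) t : ℂ) - 1‖ < η / (8 * N)}) ?_).trans ?_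
      · intro t ht
        by_contra hc
        rw [Set.mem_union, not_or] at hc
        obtain ⟨hc1, hc2⟩ := hc
        have h1 := hclose t hc1
        have h2 := blkP_close D n' n N M m hNN g (η / (8 * N)) (by positivity) t (by
          intro i hi
          by_contra hc
          exact hc2 ⟨i, hi, not_le.1 hc⟩)
        have h3 := tev_bound D g hg A hgA t
        have h4 : ‖tev t (psiP D n' M m g)‖ ≤ (2 * D + 1) * A + τ := by
          have := norm_le_insert' (tev t (psiP D n' M m g)) (tev t g)
          linarith
        have h5 : 4 / ((n + 1) * (η / (8 * N)) ^ 2) * ‖tev t (psiP D n' M m g)‖ ≤ η / 4 := by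
          have hk2 : κ ≤ η / (4 * ((2 * D + 1) * A + τ + 1)) := min_le_right _ _
          calc _ ≤ η / (4 * ((2 * D + 1) * A + τ + 1)) * ((2 * D + 1) * A + τ + 1) :=
                mul_le_mul (hn.trans hk2) (by linarith) (norm_nonneg _) (by positivity)
            _ = η / 4 := by
                have : (2 * (D : ℝ) + 1) * A + τ + 1 ≠ 0 := by positivity
                field_simp
        have h6 := norm_sub_le_norm_sub_add_norm_sub (tev t (blkP D n' n N M m g))
          (tev t (psiP D n' M m g)) (tev t g)
        have h7 : η ≤ ‖tev t (blkP D n' n N M m g) - tev t g‖ := ht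
        linarith
      · refine (measure_union_le _ _).trans ((add_le_add hv0 (hbadθ η hη)).trans ?_)
        rw [← ENNReal.ofReal_add (by positivity) (by positivity)]
        apply ENNReal.ofReal_le_ofReal; linarith
    · intro θ hθ
      have hθ0 : 0 < θ := hη.trans_le hθ
      refine (measure_mono (t := bad0 ∪ {t : AddCircle (2 * π) | ∃ i < N,
        ‖(fourier ((m * M ^ (2 * D + 1 + i) : ℕ) : ℤ) t : ℂ) - 1‖ < θ / (8 * N)}) ?_).trans ?_
      · intro t ht
        by_contra hc
        rw [Set.mem_union, not_or] at hc
        obtain ⟨hc1, hc2⟩ := hc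
        obtain ⟨N', hN'⟩ := ht
        have h1 := hclose t hc1
        have h2 := blkP_partial D n' n N M m hNN le_rfl hm8 g B hB' (θ / (8 * N)) (by positivity)
          (by
            refine le_trans ?_ (hn.trans (min_le_left _ _))
            gcongr) t (by
          intro i hi
          by_contra hc
          exact hc2 ⟨i, hi, not_le.1 hc⟩) N'
        have h3 : 2 / (θ / (8 * N) * N) = 16 / θ := by field_simp; norm_num
        rw [h3] at h2
        have h4 : ‖tev t (psiP D n' M m g)‖ ≤ ‖tev t g‖ + τ := by
          have := norm_le_insert' (tev t (psiP D n' M m g)) (tev t g)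
          linarith
        have h5 : (3 + 16 / θ) * ‖tev t (psiP D n' M m g)‖ ≤
            (3 + 16 / θ) * (‖tev t g‖ + τ) := by gcongr
        have h6 : (3 + 16 / θ) * τ ≤ η / 2 := by
          rw [← hτ1]; gcongr
        have h7 : 2 * B / N ≤ η / 2 := by
          rw [div_lt_iff₀ hη] at hN2
          rw [div_le_iff₀ hNpos]
          linarith
        linarith
      · refine (measure_union_le _ _).trans ((add_le_add hv0 (hbadθ θ hθ0)).trans ?_)
        rw [← ENNReal.ofReal_add (by positivity) (by positivity)]
        apply ENNReal.ofReal_le_ofReal; linarith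


/-! ### Lacunary enumeration -/

theorem nth_lac (ε : ℕ → ℝ) (R : ℕ) (hR2 : 2 ≤ R) (hR : ∀ n, 1 + ε n < R)
    (a nn : ℕ → ℕ) (δ : ℕ → ℝ) (hδ : ∀ j n, nn j ≤ n → ε n < δ j) (ha : ∀ j, 0 < a j)
    (hstep : ∀ j, a j * R ^ (nn j + 1) ≤ a (j + 1))
    (B : ℕ → Set ℕ) (hB1 : ∀ j, ∀ x ∈ B j, a j * R ^ (nn j + 1) ≤ x ∧ R * x ≤ a (j + 1))
    (hB2 : ∀ j, ∀ x ∈ B j, ∀ y ∈ B j, x < y → (1 + δ j) * (x : ℝ) ≤ (y : ℝ)) :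
    ∃ l : ℕ → ℕ, StrictMono l ∧ l 0 = 0 ∧
      (∀ n, 1 ≤ n → (1 + ε n) * (l n : ℝ) < (l (n + 1) : ℝ)) ∧ ∀ j, B j ⊆ Set.range l := by
  classical
  set Seg : ℕ → ℕ → Prop := fun j x => (∃ i ≤ nn j, x = a j * R ^ i) ∨ x ∈ B j with hSeg
  set X : ℕ → Prop := fun x => x = 0 ∨ ∃ j, Seg j x with hX
  have hRpos : 0 < R := by omega
  have hpow : ∀ j i, i ≤ nn j → R * (a j * R ^ i) ≤ a j * R ^ (nn j + 1) := by
    intro j i hi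
    calc R * (a j * R ^ i) = a j * R ^ (i + 1) := by ring
      _ ≤ _ := Nat.mul_le_mul_left _ (Nat.pow_le_pow_right hRpos (by omega))
  have hSlow : ∀ j x, Seg j x → a j ≤ x := by
    rintro j x (⟨i, hi, rfl⟩ | h)
    · exact Nat.le_mul_of_pos_right _ (Nat.pow_pos hRpos)
    · exact (Nat.le_mul_of_pos_right _ (Nat.pow_pos hRpos)).trans (hB1 j x h).1
  have hShigh : ∀ j x, Seg j x → R * x ≤ a (j + 1) := by
    rintro j x (⟨i, hi, rfl⟩ | h)
    · exact (hpow j i hi).trans (hstep j)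
    · exact (hB1 j x h).2
  have hastep : ∀ j, a j < a (j + 1) := by
    intro j
    have h1 := hShigh j (a j) (Or.inl ⟨0, by omega, by simp⟩)
    have := ha j
    nlinarith
  have hamono : StrictMono a := strictMono_nat_of_lt_succ hastep
  have hXinf : (setOf X).Infinite := by
    refine Set.infinite_of_injective_forall_mem hamono.injective (fun j => ?_)
    exact Or.inr ⟨j, Or.inl ⟨0, by omega, by simp⟩⟩
  have key : ∀ x y, 0 < x → x < y → X x → X y → R * x ≤ y ∨ ∃ j, x ∈ B j ∧ y ∈ B j := by
    intro x y hx hxy hXx hXy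
    rcases hXx with h | ⟨j, hj⟩
    · omega
    rcases hXy with h | ⟨j', hj'⟩
    · omega
    rcases lt_trichotomy j j' with h | h | h
    · left
      exact (hShigh j x hj).trans ((hamono.monotone (Nat.succ_le_of_lt h)).trans (hSlow j' y hj'))
    · subst h
      rcases hj with ⟨i, hi, rfl⟩ | hj
      · left
        rcases hj' with ⟨i', hi', rfl⟩ | hj'
        · have h1 : R ^ i < R ^ i' := lt_of_mul_lt_mul_left hxy (Nat.zero_le _)
          have h2 : i < i' := (Nat.pow_lt_pow_iff_right (by omega)).1 h1
          calc R * (a j * R ^ i) = a j * R ^ (i + 1) := by ring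
            _ ≤ _ := Nat.mul_le_mul_left _ (Nat.pow_le_pow_right hRpos (by omega))
        · exact (hpow j i hi).trans (hB1 j y hj').1
      · rcases hj' with ⟨i', hi', rfl⟩ | hj'
        · exfalso
          have h1 := (hB1 j x hj).1
          have h2 := hpow j i' hi'
          nlinarith
        · exact Or.inr ⟨j, hj, hj'⟩
    · exfalso
      have h1 := hShigh j' y hj'
      have h2 := hamono.monotone (Nat.succ_le_of_lt h)
      have h3 := hSlow j x hj
      have h4 : a (j' + 1) ≤ x := h2.trans h3
      nlinarith
  have hnth0 : Nat.nth X 0 = 0 := by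
    rw [Nat.nth_zero_of_zero]
    exact Or.inl rfl
  refine ⟨Nat.nth X, Nat.nth_strictMono hXinf, hnth0, ?_, ?_⟩
  · intro n hn
    have hmono := Nat.nth_strictMono hXinf
    have hpos : 0 < Nat.nth X n := by
      have := hmono (show 0 < n by omega)
      omega
    have hlt : Nat.nth X n < Nat.nth X (n + 1) := hmono (Nat.lt_succ_self n)
    rcases key _ _ hpos hlt (Nat.nth_mem_of_infinite hXinf n)
      (Nat.nth_mem_of_infinite hXinf (n + 1)) with h | ⟨j, h1, h2⟩
    · have h' : (R : ℝ) * (Nat.nth X n : ℝ) ≤ (Nat.nth X (n + 1) : ℝ) := by exact_mod_cast h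
      have hp : (0 : ℝ) < Nat.nth X n := by exact_mod_cast hpos
      have := hR n
      nlinarith
    · have hcount : nn j ≤ n := by
        have h3 : Nat.count X (Nat.nth X n) = n := Nat.count_nth_of_infinite hXinf n
        rw [Nat.count_eq_card_filter_range] at h3
        rw [← h3]
        have hinj : Function.Injective (fun i => a j * R ^ i) := by
          intro i i' h
          have h4 : R ^ i = R ^ i' := Nat.eq_of_mul_eq_mul_left (ha j) h
          exact Nat.pow_right_injective hR2 h4
        have h5 : (Finset.range (nn j)).image (fun i => a j * R ^ i) ⊆
            (Finset.range (Nat.nth X n)).filter X := by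
          intro y hy
          rw [Finset.mem_image] at hy
          obtain ⟨i, hi, rfl⟩ := hy
          rw [Finset.mem_range] at hi
          rw [Finset.mem_filter, Finset.mem_range]
          refine ⟨?_, Or.inr ⟨j, Or.inl ⟨i, hi.le, rfl⟩⟩⟩
          refine lt_of_lt_of_le ?_ (hB1 j _ h1).1
          exact Nat.mul_lt_mul_of_pos_left (Nat.pow_lt_pow_right (by omega) (by omega)) (ha j)
        have h6 := Finset.card_le_card h5
        rwa [Finset.card_image_of_injective _ hinj, Finset.card_range] at h6
      have h7 := hB2 j _ h1 _ h2 hlt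
      have h8 := hδ j n hcount
      have hp : (0 : ℝ) < Nat.nth X n := by exact_mod_cast hpos
      nlinarith
  · intro j x hx
    rw [Nat.range_nth_of_infinite hXinf]
    exact Or.inr ⟨j, Or.inr hx⟩

/-- Property of a block that allows approximating trigonometric polynomials. -/
def GoodBlock (j : ℕ) (S : Set ℤ) : Prop :=
  ∀ g : ℤ →₀ ℂ, (∀ k ∈ g.support, |k| ≤ (j : ℤ)) → (∀ k, ‖g k‖ ≤ (j : ℝ)) →
    ∃ p : ℤ →₀ ℂ, (p.support : Set ℤ) ⊆ S ∧
      volume {t : AddCircle (2 * π) | 1 / ((j : ℝ) + 1) ≤ ‖tev t p - tev t g‖} ≤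
        ENNReal.ofReal (1 / ((j : ℝ) + 1)) ∧
      ∀ θ, 1 / ((j : ℝ) + 1) ≤ θ →
        volume {t : AddCircle (2 * π) | ∃ N', (3 + 16 / θ) * ‖tev t g‖ + 1 / ((j : ℝ) + 1) <
          ‖tps N' t p‖} ≤ ENNReal.ofReal θ

theorem lac_construct (ε : ℕ → ℝ) (hεpos : ∀ n, 0 < ε n) (hεlim : Tendsto ε atTop (𝓝 0)) :
    ∃ (a : ℕ → ℕ) (S : ℕ → Set ℤ) (u v : ℕ → ℕ),
      StrictMono a ∧ (∀ j, ∀ k ∈ S j, (a j : ℤ) < |k| ∧ |k| ≤ (a (j + 1) : ℤ)) ∧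
      (∀ j, GoodBlock j (S j)) ∧
      StrictMono u ∧ u 0 = 0 ∧ (∀ n, 1 ≤ n → (1 + ε n) * (u n : ℝ) < (u (n + 1) : ℝ)) ∧
      StrictMono v ∧ v 0 = 0 ∧ (∀ n, 1 ≤ n → (1 + ε n) * (v n : ℝ) < (v (n + 1) : ℝ)) ∧
      ∀ j, ∀ k ∈ S j, (∃ n, k = (u n : ℤ)) ∨ (∃ n, k = -(v n : ℤ)) := by
  obtain ⟨M, hM⟩ := hεlim.bddAbove_range
  obtain ⟨R0, hR0⟩ := exists_nat_gt (1 + M)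
  set R := R0 + 2 with hRdef
  have hR : ∀ n, 1 + ε n < R := by
    intro n
    have := hM ⟨n, rfl⟩
    rw [hRdef]; push_cast; linarith
  have hcb := fun j : ℕ => core_block j (j : ℝ) (1 / ((j : ℝ) + 1)) (by positivity) (by positivity)
  choose δ hδpos hS using hcb
  have hn : ∀ j, ∃ n0, ∀ n, n0 ≤ n → ε n < δ j := by
    intro j
    have := hεlim.eventually_lt_const (hδpos j)
    exact eventually_atTop.1 this
  choose nn hnn using hn
  choose S0 b0 hS1 hS2 hS3 using hS
  -- the recursive construction of thresholds
  set nxt : ℕ → ℕ → ℕ := fun j x => R * (b0 j (x * R ^ (nn j + 1)) + x * R ^ (nn j + 1)) with hnxt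
  set a : ℕ → ℕ := fun j => Nat.rec 1 (fun j x => nxt j x) j with ha_def
  have ha0 : a 0 = 1 := rfl
  have has : ∀ j, a (j + 1) = R * (b0 j (a j * R ^ (nn j + 1)) + a j * R ^ (nn j + 1)) :=
    fun j => rfl
  have hRpos : 0 < R := by omega
  have hapos : ∀ j, 0 < a j := by
    intro j
    induction j with
    | zero => rw [ha0]; omega
    | succ j ih =>
      rw [has]
      have : 0 < a j * R ^ (nn j + 1) := Nat.mul_pos ih (Nat.pow_pos hRpos)
      exact Nat.mul_pos hRpos (by omega)
  have hstep : ∀ j, a j * R ^ (nn j + 1) ≤ a (j + 1) := by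
    intro j; rw [has]
    exact (Nat.le_add_left _ _).trans (Nat.le_mul_of_pos_left _ hRpos)
  have hamono : StrictMono a := strictMono_nat_of_lt_succ (fun j => by
    refine lt_of_lt_of_le ?_ (hstep j)
    have h1 : R ≤ R ^ (nn j + 1) := Nat.le_self_pow (by omega) _
    have := hapos j
    nlinarith)
  set S : ℕ → Set ℤ := fun j => S0 j (a j * R ^ (nn j + 1)) with hSdef
  have hSb : ∀ j, ∀ k ∈ S j, ((a j * R ^ (nn j + 1) : ℕ) : ℤ) < |k| ∧
      |k| ≤ (b0 j (a j * R ^ (nn j + 1)) : ℤ) := fun j => hS1 j _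
  have hgen : ∀ s : ℤ, |s| = 1 → ∃ l : ℕ → ℕ, StrictMono l ∧ l 0 = 0 ∧
      (∀ n, 1 ≤ n → (1 + ε n) * (l n : ℝ) < (l (n + 1) : ℝ)) ∧
      ∀ j, {x : ℕ | s * (x : ℤ) ∈ S j} ⊆ Set.range l := by
    intro s hs
    have habs : ∀ x : ℕ, |s * (x : ℤ)| = x := by
      intro x; rw [abs_mul, hs, one_mul]; simp
    refine nth_lac ε R (by omega) hR a nn δ hnn hapos hstep _ ?_ ?_
    · intro j x hx
      have h := hSb j _ hx
      rw [habs] at h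
      have h1 : a j * R ^ (nn j + 1) < x := by exact_mod_cast h.1
      have h2 : x ≤ b0 j (a j * R ^ (nn j + 1)) := by exact_mod_cast h.2
      refine ⟨h1.le, ?_⟩
      rw [has]
      exact Nat.mul_le_mul_left _ (by omega)
    · intro j x hx y hy hxy
      have h := hSb j _ hx
      rw [habs] at h
      have hx0 : 0 < (x : ℤ) := lt_of_le_of_lt (by positivity) h.1
      have hss : s * s = 1 := by
        rw [← abs_mul_abs_self, hs]; rfl
      have h2 := hS2 j _ _ hx _ hy (by rw [habs, habs]; exact_mod_cast hxy) (by
        have hy0 : 0 < (y : ℤ) := by omega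
        have : s * (x : ℤ) * (s * (y : ℤ)) = (s * s) * (x * y) := by ring
        rw [this, hss, one_mul]; positivity)
      rw [habs, habs] at h2
      exact_mod_cast h2
  obtain ⟨u, hu1, hu2, hu3, hu4⟩ := hgen 1 (by simp)
  obtain ⟨v, hv1, hv2, hv3, hv4⟩ := hgen (-1) (by simp)
  refine ⟨a, S, u, v, hamono, ?_, ?_, hu1, hu2, hu3, hv1, hv2, hv3, ?_⟩
  · intro j k hk
    have h := hSb j k hk
    constructor
    · refine lt_of_le_of_lt ?_ h.1
      exact_mod_cast Nat.le_mul_of_pos_right _ (Nat.pow_pos hRpos)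
    · refine h.2.trans ?_
      rw [has]
      exact_mod_cast (Nat.le_add_right _ _).trans (Nat.le_mul_of_pos_left _ hRpos)
  · intro j
    exact hS3 j _
  · intro j k hk
    rcases Int.natAbs_eq k with h | h
    · left
      obtain ⟨n, hn⟩ := hu4 j (show k.natAbs ∈ {x : ℕ | (1 : ℤ) * (x : ℤ) ∈ S j} by
        show (1 : ℤ) * (k.natAbs : ℤ) ∈ S j
        rw [one_mul, ← h]; exact hk)
      exact ⟨n, by rw [hn]; exact h⟩
    · right
      obtain ⟨n, hn⟩ := hv4 j (show k.natAbs ∈ {x : ℕ | (-1 : ℤ) * (x : ℤ) ∈ S j} by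
        show (-1 : ℤ) * (k.natAbs : ℤ) ∈ S j
        rw [neg_one_mul, ← h]; exact hk)
      exact ⟨n, by rw [hn]; exact h⟩

/-! ### Global assembly -/

lemma finsupp_bounds (g : ℤ →₀ ℂ) : ∃ J : ℕ, ∀ j, J ≤ j →
    (∀ k ∈ g.support, |k| ≤ (j : ℤ)) ∧ ∀ k, ‖g k‖ ≤ (j : ℝ) := by
  obtain ⟨B, hB⟩ := exists_nat_ge (∑ k ∈ g.support, ‖g k‖)
  refine ⟨(∑ k ∈ g.support, k.natAbs) + B, fun j hj => ⟨fun k hk => ?_, fun k => ?_⟩⟩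
  · have h1 : k.natAbs ≤ ∑ k ∈ g.support, k.natAbs :=
      Finset.single_le_sum (f := fun k : ℤ => k.natAbs) (fun _ _ => Nat.zero_le _) hk
    rw [Int.abs_eq_natAbs]
    omega
  · have hBj : (B : ℝ) ≤ (j : ℝ) := by exact_mod_cast (by omega : B ≤ j)
    by_cases hk : k ∈ g.support
    · have h1 : ‖g k‖ ≤ ∑ k ∈ g.support, ‖g k‖ :=
        Finset.single_le_sum (f := fun k : ℤ => ‖g k‖) (fun _ _ => norm_nonneg _) hk
      linarith
    · rw [Finsupp.notMem_support_iff.1 hk, norm_zero]; positivity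

lemma asm_step (S : ℕ → Set ℤ) (hS : ∀ j, GoodBlock j (S j)) (f : AddCircle (2 * π) → ℂ)
    (hf : Measurable f) (q : ℤ →₀ ℂ) (J i : ℕ) :
    ∃ (j : ℕ) (p g : ℤ →₀ ℂ), J ≤ j ∧ (p.support : Set ℤ) ⊆ S j ∧
      volume {t : AddCircle (2 * π) | (1 / 4 : ℝ) ^ i ≤ ‖f t - tev t q - tev t g‖} ≤
        ENNReal.ofReal ((1 / 4 : ℝ) ^ i) ∧
      volume {t : AddCircle (2 * π) | 2 * (1 / 4 : ℝ) ^ i ≤ ‖f t - tev t (q + p)‖} ≤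
        ENNReal.ofReal (2 * (1 / 4 : ℝ) ^ i) ∧
      volume {t : AddCircle (2 * π) | ∃ N', (3 + 16 * 2 ^ i) * ‖tev t g‖ + (1 / 4 : ℝ) ^ i <
          ‖tps N' t p‖} ≤ ENNReal.ofReal ((1 / 2 : ℝ) ^ i) := by
  have he : (0 : ℝ) < (1 / 4 : ℝ) ^ i := by positivity
  obtain ⟨g, hg⟩ := trig_dense (fun t => f t - tev t q) (hf.sub (tev_continuous q).measurable) _ he
  obtain ⟨J1, hJ1⟩ := finsupp_bounds g
  set j := J + J1 + 4 ^ i with hj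
  have hη : 1 / ((j : ℝ) + 1) ≤ (1 / 4 : ℝ) ^ i := by
    rw [one_div_pow]
    apply one_div_le_one_div_of_le (by positivity)
    rw [hj]; push_cast
    have h1 : (0 : ℝ) ≤ J := by positivity
    have h2 : (0 : ℝ) ≤ J1 := by positivity
    linarith
  have h42 : (1 / 4 : ℝ) ^ i ≤ (1 / 2 : ℝ) ^ i := by gcongr; norm_num
  have hj1 : J1 ≤ j := by rw [hj]; exact (Nat.le_add_left _ _).trans (Nat.le_add_right _ _)
  have hj0 : J ≤ j := by
    rw [hj, Nat.add_assoc]; exact Nat.le_add_right _ _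
  obtain ⟨hb1, hb2⟩ := hJ1 j hj1
  obtain ⟨p, hp1, hp2, hp3⟩ := hS j g hb1 hb2
  refine ⟨j, p, g, hj0, hp1, hg, ?_, ?_⟩
  · refine (measure_mono (t := {t : AddCircle (2 * π) | (1 / 4 : ℝ) ^ i ≤ ‖f t - tev t q - tev t g‖} ∪
      {t : AddCircle (2 * π) | 1 / ((j : ℝ) + 1) ≤ ‖tev t p - tev t g‖}) ?_).trans ?_
    · intro t ht
      by_contra hc
      rw [Set.mem_union, not_or] at hc
      have h1 : ‖f t - tev t q - tev t g‖ < (1 / 4 : ℝ) ^ i := not_le.1 hc.1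
      have h2 : ‖tev t p - tev t g‖ < 1 / ((j : ℝ) + 1) := not_le.1 hc.2
      have h3 : 2 * (1 / 4 : ℝ) ^ i ≤ ‖f t - tev t (q + p)‖ := ht
      have h4 : f t - tev t (q + p) = (f t - tev t q - tev t g) - (tev t p - tev t g) := by
        rw [map_add]; ring
      rw [h4] at h3
      have h5 := norm_sub_le (f t - tev t q - tev t g) (tev t p - tev t g)
      linarith
    · refine (measure_union_le _ _).trans ((add_le_add hg hp2).trans ?_)
      rw [← ENNReal.ofReal_add (by positivity) (by positivity)]
      apply ENNReal.ofReal_le_ofReal; linarith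
  · refine le_trans (measure_mono ?_) (hp3 ((1 / 2 : ℝ) ^ i) (hη.trans h42))
    rintro t ⟨N', hN'⟩
    refine ⟨N', ?_⟩
    have h1 : (16 : ℝ) / (1 / 2 : ℝ) ^ i = 16 * 2 ^ i := by
      rw [one_div_pow]; field_simp
    rw [h1]
    linarith

lemma asm_seq (S : ℕ → Set ℤ) (hS : ∀ j, GoodBlock j (S j)) (f : AddCircle (2 * π) → ℂ)
    (hf : Measurable f) :
    ∃ (jj : ℕ → ℕ) (pp gg qq : ℕ → (ℤ →₀ ℂ)), StrictMono jj ∧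
      (∀ i, ((pp i).support : Set ℤ) ⊆ S (jj i)) ∧
      (∀ i, qq i = ∑ i' ∈ Finset.range i, pp i') ∧ ∀ i,
      volume {t : AddCircle (2 * π) | (1 / 4 : ℝ) ^ i ≤ ‖f t - tev t (qq i) - tev t (gg i)‖} ≤
        ENNReal.ofReal ((1 / 4 : ℝ) ^ i) ∧
      volume {t : AddCircle (2 * π) | 2 * (1 / 4 : ℝ) ^ i ≤ ‖f t - tev t (qq (i + 1))‖} ≤
        ENNReal.ofReal (2 * (1 / 4 : ℝ) ^ i) ∧
      volume {t : AddCircle (2 * π) | ∃ N', (3 + 16 * 2 ^ i) * ‖tev t (gg i)‖ + (1 / 4 : ℝ) ^ i <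
          ‖tps N' t (pp i)‖} ≤ ENNReal.ofReal ((1 / 2 : ℝ) ^ i) := by
  choose J P G h1 h2 h3 h4 h5 using asm_step S hS f hf
  set st : ℕ → (ℤ →₀ ℂ) × ℕ := fun i =>
    Nat.rec (0, 0) (fun i s => (s.1 + P s.1 s.2 i, J s.1 s.2 i + 1)) i with hst
  have hs : ∀ i, st (i + 1) =
      ((st i).1 + P (st i).1 (st i).2 i, J (st i).1 (st i).2 i + 1) := fun i => rfl
  refine ⟨fun i => J (st i).1 (st i).2 i, fun i => P (st i).1 (st i).2 i,
    fun i => G (st i).1 (st i).2 i, fun i => (st i).1, ?_, fun i => h2 _ _ _, ?_, fun i => ?_⟩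
  · refine strictMono_nat_of_lt_succ fun i => ?_
    have := h1 (st (i + 1)).1 (st (i + 1)).2 (i + 1)
    have h6 : (st (i + 1)).2 = J (st i).1 (st i).2 i + 1 := by rw [hs]
    omega
  · intro i
    induction i with
    | zero => rfl
    | succ i ih =>
      rw [Finset.sum_range_succ, ← ih]
  · exact ⟨h3 _ _ _, h4 _ _ _, h5 _ _ _⟩

lemma tps_eq_sum (N : ℕ) (t : AddCircle (2 * π)) (q : ℤ →₀ ℂ) :
    tps N t q = ∑ k ∈ Finset.Icc (-(N : ℤ)) (N : ℤ), q k * fourier k t := by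
  simp only [tps, Finsupp.linearCombination_apply, Finsupp.sum, smul_eq_mul, mul_ite, mul_zero]
  rw [← Finset.sum_filter]
  refine Finset.sum_subset_zero_on_sdiff ?_ ?_ (fun _ _ => rfl)
  · intro k hk
    rw [Finset.mem_filter, abs_le] at hk
    exact Finset.mem_Icc.2 hk.2
  · intro k hk
    rw [Finset.mem_sdiff, Finset.mem_filter, not_and, abs_le, Finset.mem_Icc] at hk
    have : k ∉ q.support := fun h => hk.2 h hk.1
    rw [Finsupp.notMem_support_iff.1 this, zero_mul]

lemma summable_bc (E : ℕ → Set (AddCircle (2 * π))) (C : ℝ) (hC : 0 ≤ C) (r : ℝ) (hr : 0 ≤ r)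
    (hr1 : r < 1) (h : ∀ i, volume (E i) ≤ ENNReal.ofReal (C * r ^ i)) :
    ∀ᵐ t : AddCircle (2 * π), ∀ᶠ i in atTop, t ∉ E i := by
  apply ae_eventually_notMem
  have hsum : Summable (fun i : ℕ => C * r ^ i) := (summable_geometric_of_lt_one hr hr1).mul_left C
  refine ne_top_of_le_ne_top ?_ (ENNReal.tsum_le_tsum h)
  rw [← ENNReal.ofReal_tsum_of_nonneg (fun i => by positivity) hsum]
  exact ENNReal.ofReal_ne_top

theorem menshov_of_blocks (a : ℕ → ℕ) (S : ℕ → Set ℤ) (ha : StrictMono a)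
    (hSa : ∀ j, ∀ k ∈ S j, (a j : ℤ) < |k| ∧ |k| ≤ (a (j + 1) : ℤ))
    (hS : ∀ j, GoodBlock j (S j)) (Λ : Set ℤ) (hΛ : ∀ j, S j ⊆ Λ) : IsMenshovSpectrum Λ := by
  intro f hf
  obtain ⟨jj, pp, gg, qq, hjj, hpp, hqq, hm⟩ := asm_seq S hS f hf
  set b : ℕ → ℕ := fun i => a (jj i) with hb
  have hbm : StrictMono b := ha.comp hjj
  have hib : ∀ i, i ≤ b i := fun i => hbm.id_le i
  have hsup : ∀ i k, pp i k ≠ 0 → (b i : ℤ) < |k| ∧ |k| ≤ (b (i + 1) : ℤ) := by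
    intro i k hk
    have h1 := hSa (jj i) k (hpp i (by simpa using hk))
    refine ⟨h1.1, h1.2.trans ?_⟩
    exact_mod_cast ha.monotone (Nat.succ_le_of_lt (hjj (Nat.lt_succ_self i)))
  have hqk : ∀ k m, qq m k = ∑ i ∈ Finset.range m, pp i k := by
    intro k m; rw [hqq, Finsupp.finsetSum_apply]
  have hq0 : ∀ k m m', (∀ i, m ≤ i → pp i k = 0) → m ≤ m' → qq m' k = qq m k := by
    intro k m m' h hmm
    rw [hqk, hqk]
    symm
    refine Finset.sum_subset (Finset.range_mono hmm) fun i _ hi => h i ?_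
    simpa using hi
  have hq1 : ∀ k m m', (∀ i, m ≤ i → pp i k = 0) → (∀ i, m' ≤ i → pp i k = 0) →
      qq m' k = qq m k := by
    intro k m m' h h'
    rw [← hq0 k m (max m m') h (le_max_left _ _), ← hq0 k m' (max m m') h' (le_max_right _ _)]
  have hΛ0 : ∀ i k, k ∉ Λ → pp i k = 0 := by
    intro i k hk
    by_contra hc
    exact hk (hΛ _ (hpp i (by simpa using hc)))
  refine ⟨fun k => qq (k.natAbs + 1) k, ?_⟩
  have hA := summable_bc _ 1 (by norm_num) (1 / 4) (by norm_num) (by norm_num)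
    (fun i => (hm i).1.trans_eq (by rw [one_mul]))
  have hB := summable_bc _ 2 (by norm_num) (1 / 4) (by norm_num) (by norm_num)
    (fun i => (hm i).2.1)
  have hC := summable_bc _ 1 (by norm_num) (1 / 2) (by norm_num) (by norm_num)
    (fun i => (hm i).2.2.trans_eq (by rw [one_mul]))
  filter_upwards [hA, hB, hC] with t hAt hBt hCt
  obtain ⟨I0, hI0⟩ := eventually_atTop.1 (hAt.and (hBt.and hCt))
  have hgood : ∀ i, I0 + 1 ≤ i → ∀ N, ‖f t - tev t (qq i)‖ + ‖tps N t (pp i)‖ ≤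
      300 * (1 / 2 : ℝ) ^ i := by
    intro i hi N
    obtain ⟨i, rfl⟩ : ∃ i', i = i' + 1 := ⟨i - 1, by omega⟩
    have h1 : ‖f t - tev t (qq (i + 1)) - tev t (gg (i + 1))‖ < (1 / 4 : ℝ) ^ (i + 1) :=
      not_le.1 (hI0 (i + 1) (by omega)).1
    have h2 : ‖f t - tev t (qq (i + 1))‖ < 2 * (1 / 4 : ℝ) ^ i :=
      not_le.1 (hI0 i (by omega)).2.1
    have h3 : ‖tps N t (pp (i + 1))‖ ≤
        (3 + 16 * 2 ^ (i + 1)) * ‖tev t (gg (i + 1))‖ + (1 / 4 : ℝ) ^ (i + 1) := by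
      by_contra hc
      exact (hI0 (i + 1) (by omega)).2.2 ⟨N, not_le.1 hc⟩
    have h4 : ‖tev t (gg (i + 1))‖ ≤ 9 * (1 / 4 : ℝ) ^ (i + 1) := by
      have h5 : tev t (gg (i + 1)) = (f t - tev t (qq (i + 1))) -
        (f t - tev t (qq (i + 1)) - tev t (gg (i + 1))) := by ring
      rw [h5]
      refine (norm_sub_le _ _).trans ?_
      have h6 : (1 / 4 : ℝ) ^ i = 4 * (1 / 4 : ℝ) ^ (i + 1) := by rw [pow_succ]; ring
      linarith
    have h7 : (1 / 4 : ℝ) ^ i = 4 * (1 / 4 : ℝ) ^ (i + 1) := by rw [pow_succ]; ring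
    have h8 : (1 / 4 : ℝ) ^ (i + 1) = (1 / 2 : ℝ) ^ (i + 1) * (1 / 2 : ℝ) ^ (i + 1) := by
      rw [← mul_pow]; norm_num
    have h9 : (2 : ℝ) ^ (i + 1) * (1 / 2 : ℝ) ^ (i + 1) = 1 := by
      rw [← mul_pow]; norm_num
    have h10 : (1 / 2 : ℝ) ^ (i + 1) ≤ 1 := pow_le_one₀ (by norm_num) (by norm_num)
    have h11 : (0 : ℝ) < (1 / 2 : ℝ) ^ (i + 1) := by positivity
    have h12 : (1 / 4 : ℝ) ^ (i + 1) ≤ (1 / 2 : ℝ) ^ (i + 1) := by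
      rw [h8]; nlinarith
    have h13 : (2 : ℝ) ^ (i + 1) * (1 / 4 : ℝ) ^ (i + 1) = (1 / 2 : ℝ) ^ (i + 1) := by
      rw [h8, ← mul_assoc, h9, one_mul]
    have h14 : (3 + 16 * 2 ^ (i + 1)) * ‖tev t (gg (i + 1))‖ ≤
        (3 + 16 * 2 ^ (i + 1)) * (9 * (1 / 4 : ℝ) ^ (i + 1)) := by gcongr
    have h15 : (3 + 16 * 2 ^ (i + 1)) * (9 * (1 / 4 : ℝ) ^ (i + 1)) =
        27 * (1 / 4 : ℝ) ^ (i + 1) + 144 * ((2 : ℝ) ^ (i + 1) * (1 / 4 : ℝ) ^ (i + 1)) := by ring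
    rw [h13] at h15
    linarith
  rw [Metric.tendsto_atTop]
  intro e he
  have hlim : Tendsto (fun i : ℕ => 300 * (1 / 2 : ℝ) ^ i) atTop (𝓝 0) := by
    have := (tendsto_pow_atTop_nhds_zero_of_lt_one (r := (1 / 2 : ℝ)) (by norm_num)
      (by norm_num)).const_mul 300
    simpa using this
  obtain ⟨I1, hI1⟩ := eventually_atTop.1 (hlim.eventually_lt_const he)
  set I2 := I0 + 1 + I1 with hI2
  refine ⟨b I2, fun N hN => ?_⟩
  classical
  set I := Nat.findGreatest (fun i => b i ≤ N) N with hI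
  have hIb : b I ≤ N := Nat.findGreatest_spec (P := fun i => b i ≤ N) ((hib I2).trans hN) hN
  have hI2I : I2 ≤ I := Nat.le_findGreatest ((hib I2).trans hN) hN
  have hIN : N < b (I + 1) := by
    by_contra hc
    rw [not_lt] at hc
    have h1 : I + 1 ≤ I := Nat.le_findGreatest ((hib (I + 1)).trans hc) hc
    omega
  have hps : menshovPartialSum Λ (fun k => qq (k.natAbs + 1) k) N t =
      tev t (qq I) + tps N t (pp I) := by
    have h1 : tps N t (qq I) = tev t (qq I) := by
      refine tps_eq_tev N t _ fun k hk => ?_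
      rw [Finsupp.mem_support_iff, hqk] at hk
      obtain ⟨i, hi, hik⟩ := Finset.exists_ne_zero_of_sum_ne_zero hk
      rw [Finset.mem_range] at hi
      refine (hsup i k hik).2.trans ?_
      exact_mod_cast (hbm.monotone (Nat.succ_le_of_lt hi)).trans hIb
    have h2 : qq (I + 1) = qq I + pp I := by
      rw [hqq, hqq, Finset.sum_range_succ]
    rw [← h1, ← map_add, ← h2, tps_eq_sum]
    refine Finset.sum_congr rfl fun k hk => ?_
    congr 1
    have hz1 : ∀ i, k.natAbs + 1 ≤ i → pp i k = 0 := by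
      intro i hi
      by_contra hc
      have h3 := (hsup i k hc).1
      rw [Int.abs_eq_natAbs] at h3
      have h4 := hib i
      omega
    have hz2 : ∀ i, I + 1 ≤ i → pp i k = 0 := by
      intro i hi
      by_contra hc
      have h3 := (hsup i k hc).1
      rw [Int.abs_eq_natAbs] at h3
      have h4 : b (I + 1) ≤ b i := hbm.monotone hi
      rw [Finset.mem_Icc] at hk
      omega
    by_cases hkΛ : k ∈ Λ
    · rw [Set.indicator_of_mem hkΛ]
      exact hq1 k _ _ hz2 hz1
    · rw [Set.indicator_of_notMem hkΛ, hqk]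
      exact (Finset.sum_eq_zero fun i _ => hΛ0 i k hkΛ).symm
  rw [hps, dist_eq_norm]
  have h1 : tev t (qq I) + tps N t (pp I) - f t = tps N t (pp I) - (f t - tev t (qq I)) := by ring
  rw [h1]
  refine (norm_sub_le _ _).trans_lt ?_
  have h2 := hgood I (by omega) N
  have h3 := hI1 I (by omega)
  linarith

/-- **Theorem 1**: for every positive sequence `ε(n) → 0` there is a Menshov spectrum
`Λ = {λ(n) : n ∈ ℤ}`, enumerated in increasing order, with `λ(n) > 0` and `λ(-n) < 0`
for `n ≥ 1`, such that `λ(n+1)/λ(n) > 1 + ε(n)` and `λ(-n-1)/λ(-n) > 1 + ε(n)` for all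
`n ≥ 1`. -/
theorem lacunary_menshov_spectrum (ε : ℕ → ℝ) (hεpos : ∀ n, 0 < ε n)
    (hεlim : Tendsto ε atTop (𝓝 0)) :
    ∃ (Λ : Set ℤ) (l : ℤ → ℤ),
      StrictMono l ∧
      Set.range l = Λ ∧
      (∀ n : ℕ, 1 ≤ n → 0 < l (n : ℤ)) ∧
      (∀ n : ℕ, 1 ≤ n → l (-(n : ℤ)) < 0) ∧
      (∀ n : ℕ, 1 ≤ n → ((l ((n : ℤ) + 1) : ℝ)) / ((l (n : ℤ) : ℝ)) > 1 + ε n) ∧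
      (∀ n : ℕ, 1 ≤ n → ((l (-(n : ℤ) - 1) : ℝ)) / ((l (-(n : ℤ)) : ℝ)) > 1 + ε n) ∧
      IsMenshovSpectrum Λ := by
  obtain ⟨a, S, u, v, ha, hSa, hS, hu, hu0, hu1, hv, hv0, hv1, hcov⟩ :=
    lac_construct ε hεpos hεlim
  set l : ℤ → ℤ := fun n => if 0 ≤ n then (u n.natAbs : ℤ) else -(v n.natAbs : ℤ) with hl
  have hlp : ∀ n : ℕ, l (n : ℤ) = u n := by
    intro n; simp [hl]
  have hln : ∀ n : ℕ, l (-(n : ℤ)) = -(v n : ℤ) := by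
    intro n
    rcases Nat.eq_zero_or_pos n with rfl | h
    · simp [hl, hu0, hv0]
    · have : ¬ (0 : ℤ) ≤ -(n : ℤ) := by omega
      simp only [hl, if_neg this, Int.natAbs_neg, Int.natAbs_natCast]
  have hupos : ∀ n : ℕ, 1 ≤ n → 0 < u n := by
    intro n hn
    have := hu (show 0 < n by omega)
    omega
  have hvpos : ∀ n : ℕ, 1 ≤ n → 0 < v n := by
    intro n hn
    have := hv (show 0 < n by omega)
    omega
  refine ⟨Set.range l, l, ?_, rfl, ?_, ?_, ?_, ?_, ?_⟩
  · refine strictMono_int_of_lt_succ fun n => ?_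
    rcases le_or_gt 0 n with h | h
    · obtain ⟨m, rfl⟩ := Int.eq_ofNat_of_zero_le h
      have h1 := hlp (m + 1)
      push_cast at h1
      rw [h1, hlp]
      exact_mod_cast hu (Nat.lt_succ_self m)
    · obtain ⟨m, hm⟩ : ∃ m : ℕ, n = -((m + 1 : ℕ) : ℤ) := ⟨n.natAbs - 1, by omega⟩
      have h2 : n + 1 = -(m : ℤ) := by rw [hm]; push_cast; ring
      rw [h2, hm, hln, hln]
      have := hv (Nat.lt_succ_self m)
      simp only [Nat.succ_eq_add_one] at this
      omega
  · intro n hn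
    rw [hlp]; exact_mod_cast hupos n hn
  · intro n hn
    rw [hln]
    have := hvpos n hn
    omega
  · intro n hn
    have h1 := hlp (n + 1)
    push_cast at h1
    rw [h1, hlp]
    have hp : (0 : ℝ) < ((u n : ℤ) : ℝ) := by exact_mod_cast hupos n hn
    rw [gt_iff_lt, lt_div_iff₀ hp]
    exact_mod_cast hu1 n hn
  · intro n hn
    have h1 := hln (n + 1)
    have h2 : -(n : ℤ) - 1 = -((n + 1 : ℕ) : ℤ) := by push_cast; ring
    rw [h2, h1, hln]
    have hp : (0 : ℝ) < ((v n : ℤ) : ℝ) := by exact_mod_cast hvpos n hn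
    push_cast
    rw [gt_iff_lt, neg_div_neg_eq, lt_div_iff₀ (by exact_mod_cast hp)]
    exact hv1 n hn
  · refine menshov_of_blocks a S ha hSa hS _ fun j k hk => ?_
    rcases hcov j k hk with ⟨n, rfl⟩ | ⟨n, rfl⟩
    · exact ⟨n, hlp n⟩
    · exact ⟨-(n : ℤ), hln n⟩
end
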